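/- arXiv:2006.07085 — 2 statements merged into one kernel-verified Lean document; each statement's English description precedes it below -/
import Mathlib

section
/- Let ω ≠ 0 be real and let χ₂, Ω₁ : ℝ → ℝ be continuous 2π-periodic functions with I := ∫₀^{2π} χ₂(φ) dφ ≠ 0. For a parameter μ ∈ ℝ consider the non-autonomous scalar ODE r'(φ) = (μ·r(φ) + r(φ)²·χ₂(φ)) / (ω + r(φ)·Ω₁(φ)). Then there exist ε, δ, C > 0 such that for every μ with 0 < |μ| < ε: (i) if μ·I < 0, there exists a unique r₀ ∈ (0, δ) for which there is a differentiable function r : [0, 2π] → (0, δ) solving the ODE with r(0) = r₀ and r(2π) = r₀, and this r₀ satisfies |r₀ + 2πμ/I| ≤ C·μ²; (ii) if μ·I > 0, there is no r₀ ∈ (0, δ) with this property. In particular the bifurcating periodic radii satisfy r₀ = −(2π/I)·μ + O(μ²), and the sign of I determines the criticality of the bifurcation. -/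
open Real Set

/-- `r₀` admits a solution `r : [0,2π] → (0,δ)` of the angle-parametrized radial ODE
`r' = (μr + r²χ₂(φ))/(ω + rΩ₁(φ))` with `r(0) = r(2π) = r₀`. -/
def SolvesRadialBVP (ω μ δ : ℝ) (χ₂ Ω₁ : ℝ → ℝ) (r₀ : ℝ) : Prop :=
  ∃ r : ℝ → ℝ,
    (∀ φ ∈ Icc (0:ℝ) (2 * π), r φ ∈ Ioo 0 δ) ∧
    (∀ φ ∈ Icc (0:ℝ) (2 * π),
      HasDerivAt r ((μ * r φ + (r φ) ^ 2 * χ₂ φ) / (ω + r φ * Ω₁ φ)) φ) ∧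
    r 0 = r₀ ∧ r (2 * π) = r₀

lemma den_pos {r δ W M : ℝ} (hr : 0 ≤ r) (hrd : r ≤ δ) (hW : |W| ≤ M) (hd : δ * M ≤ 1/2) :
    1/2 ≤ 1 + r * W := by
  have hM : 0 ≤ M := (abs_nonneg _).trans hW
  have h1 : |r * W| ≤ δ * M := by
    rw [abs_mul, abs_of_nonneg hr]
    exact mul_le_mul hrd hW (abs_nonneg _) (hr.trans hrd)
  have := neg_abs_le (r * W)
  linarith

lemma abs_num {m r X M : ℝ} (hr : 0 ≤ r) (hX : |X| ≤ M) : |m + r * X| ≤ |m| + r * M := by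
  refine (abs_add_le _ _).trans ?_
  rw [abs_mul, abs_of_nonneg hr]
  gcongr

lemma div_le_two {a b D : ℝ} (hD : 1/2 ≤ D) (h : |a| ≤ b) : |a / D| ≤ 2 * b := by
  have hb : 0 ≤ b := (abs_nonneg _).trans h
  rw [abs_div, abs_of_pos (show 0 < D by linarith), div_le_iff₀ (by linarith)]
  nlinarith

lemma p1 {m r δ X W M : ℝ} (hr : 0 ≤ r) (hrd : r ≤ δ) (hX : |X| ≤ M) (hW : |W| ≤ M)
    (hd : δ * M ≤ 1/2) : |(m * r + r ^ 2 * X) / (1 + r * W)| ≤ 2 * (|m| + r * M) * r := by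
  have h := div_le_two (den_pos hr hrd hW hd) (abs_num (m := m) hr hX)
  have e : (m * r + r ^ 2 * X) / (1 + r * W) = (m + r * X) / (1 + r * W) * r := by ring
  rw [e, abs_mul, abs_of_nonneg hr]
  gcongr

lemma p3 {m r δ X W M : ℝ} (hr : 0 ≤ r) (hrd : r ≤ δ) (hX : |X| ≤ M) (hW : |W| ≤ M)
    (hd : δ * M ≤ 1/2) :
    |(m + r * X) / (1 + r * W) - m - r * X| ≤ 2 * (|m| + r * M) * (r * M) := by
  have hD := den_pos hr hrd hW hd
  have h := div_le_two hD (abs_num (m := m) hr hX)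
  have e : (m + r * X) / (1 + r * W) - m - r * X
      = - ((m + r * X) / (1 + r * W) * (r * W)) := by
    have : (1 + r * W) ≠ 0 := by linarith
    field_simp
    ring
  rw [e, abs_neg, abs_mul, abs_mul, abs_of_nonneg hr]
  have := (abs_nonneg _).trans h
  gcongr

lemma p2 {m r q δ X W M : ℝ} (hr : 0 ≤ r) (hrd : r ≤ δ) (hq : 0 ≤ q) (hqd : q ≤ δ)
    (hX : |X| ≤ M) (hW : |W| ≤ M) (hd : δ * M ≤ 1/2) :
    |(m * q + q ^ 2 * X) / (1 + q * W) - (m * r + r ^ 2 * X) / (1 + r * W)|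
      ≤ 4 * (|m| + 3 * δ * M) * |q - r| := by
  have hM : 0 ≤ M := (abs_nonneg _).trans hX
  have hδ : 0 ≤ δ := hr.trans hrd
  have hD := den_pos hr hrd hW hd
  have hE := den_pos hq hqd hW hd
  have e : (m * q + q ^ 2 * X) / (1 + q * W) - (m * r + r ^ 2 * X) / (1 + r * W)
      = (m + (q + r) * X + q * X * (r * W)) / (1 + q * W) / (1 + r * W) * (q - r) := by
    have hr1 : (1 + r * W) ≠ 0 := by linarith
    have hq1 : (1 + q * W) ≠ 0 := by linarith
    generalize hA : 1 + r * W = A at *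
    generalize hB : 1 + q * W = B at *
    field_simp
    subst hA hB
    ring
  have h1 : |m + (q + r) * X + q * X * (r * W)| ≤ |m| + 3 * δ * M := by
    have a1 := abs_num (m := m) (add_nonneg hq hr) hX
    have a2 : |q * X * (r * W)| ≤ (δ * M) * (δ * M) := by
      rw [abs_mul, abs_mul, abs_mul, abs_of_nonneg hq, abs_of_nonneg hr]
      gcongr
    have a3 := abs_add_le (m + (q + r) * X) (q * X * (r * W))
    have hdM : 0 ≤ δ * M := mul_nonneg (hr.trans hrd) hM
    nlinarith
  have h2 := div_le_two hD (div_le_two hE h1)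
  rw [e, abs_mul]
  gcongr
  linarith

lemma p4 {m r q δ X W M : ℝ} (d₀ : ℝ) (hr : 0 ≤ r) (hrd : r ≤ δ) (hq : 0 ≤ q) (hqd : q ≤ δ)
    (hX : |X| ≤ M) (hW : |W| ≤ M) (hd : δ * M ≤ 1/2) :
    |(m + q * X) / (1 + q * W) - (m + r * X) / (1 + r * W) - d₀ * X|
      ≤ |(q - r) - d₀| * M + 4 * (M * (|m| + 3 * δ * M)) * |q - r| := by
  have hM : 0 ≤ M := (abs_nonneg _).trans hX
  have hδ : 0 ≤ δ := hr.trans hrd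
  have hD := den_pos hr hrd hW hd
  have hE := den_pos hq hqd hW hd
  have e : (m + q * X) / (1 + q * W) - (m + r * X) / (1 + r * W) - d₀ * X
      = ((q - r) - d₀) * X +
        (- (m * W + X * ((q + r) * W + q * W * (r * W)))) / (1 + q * W) / (1 + r * W)
          * (q - r) := by
    have hr1 : (1 + r * W) ≠ 0 := by linarith
    have hq1 : (1 + q * W) ≠ 0 := by linarith
    generalize hA : 1 + r * W = A at *
    generalize hB : 1 + q * W = B at *
    field_simp
    subst hA hB
    ring
  have h1 : |- (m * W + X * ((q + r) * W + q * W * (r * W)))| ≤ M * (|m| + 3 * δ * M) := by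
    rw [abs_neg]
    have hdM : 0 ≤ δ * M := mul_nonneg (hr.trans hrd) hM
    have a1 : |(q + r) * W| ≤ 2 * (δ * M) := by
      rw [abs_mul, abs_of_nonneg (add_nonneg hq hr)]
      calc (q + r) * |W| ≤ (δ + δ) * M := by gcongr
        _ = _ := by ring
    have a2 : |q * W * (r * W)| ≤ (δ * M) * (δ * M) := by
      rw [abs_mul, abs_mul, abs_mul, abs_of_nonneg hq, abs_of_nonneg hr]
      gcongr
    have a3 : |(q + r) * W + q * W * (r * W)| ≤ 3 * δ * M :=
      (abs_add_le _ _).trans (by nlinarith)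
    calc _ ≤ |m * W| + |X * ((q + r) * W + q * W * (r * W))| := abs_add_le _ _
      _ ≤ |m| * M + M * (3 * δ * M) := by
        rw [abs_mul, abs_mul]
        gcongr
      _ = _ := by ring
  have h2 := div_le_two hD (div_le_two hE h1)
  rw [e]
  refine (abs_add_le _ _).trans ?_
  rw [abs_mul, abs_mul _ (q - r)]
  gcongr
  linarith

lemma two_pi_le : 2 * π ≤ 7 := by linarith [pi_lt_d2]

/-- Mean value bound on `[0, 2π]`. -/
lemma mv {u u' : ℝ → ℝ} {C : ℝ} (hu : ∀ φ ∈ Icc (0:ℝ) (2 * π), HasDerivAt u (u' φ) φ)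
    (hb : ∀ φ ∈ Icc (0:ℝ) (2 * π), |u' φ| ≤ C) :
    ∀ φ ∈ Icc (0:ℝ) (2 * π), |u φ - u 0| ≤ 7 * C := by
  intro φ hφ
  have h0 : (0:ℝ) ∈ Icc (0:ℝ) (2 * π) := ⟨le_rfl, by positivity⟩
  have hC : 0 ≤ C := (abs_nonneg _).trans (hb 0 h0)
  have := (convex_Icc (0:ℝ) (2*π)).norm_image_sub_le_of_norm_hasDerivWithin_le
    (fun x hx => (hu x hx).hasDerivWithinAt) hb h0 hφ
  rw [Real.norm_eq_abs, Real.norm_eq_abs, sub_zero, abs_of_nonneg hφ.1] at this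
  have h7 := two_pi_le
  nlinarith [hφ.2]

lemma gron {u u' : ℝ → ℝ} {L : ℝ} (hL0 : 0 ≤ L) (hL : 7 * L ≤ 1)
    (hu : ∀ φ ∈ Icc (0:ℝ) (2 * π), HasDerivAt u (u' φ) φ)
    (hb : ∀ φ ∈ Icc (0:ℝ) (2 * π), |u' φ| ≤ L * |u φ|) :
    ∀ φ ∈ Icc (0:ℝ) (2 * π), |u φ| ≤ 3 * |u 0| ∧ |u φ - u 0| ≤ 21 * L * |u 0| := by
  have h1 : ∀ φ ∈ Icc (0:ℝ) (2 * π), |u φ| ≤ 3 * |u 0| := by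
    intro φ hφ
    have := norm_le_gronwallBound_of_norm_deriv_right_le (f := u) (f' := u') (δ := |u 0|)
      (K := L) (ε := 0) (a := 0) (b := 2 * π)
      (fun x hx => (hu x hx).continuousAt.continuousWithinAt)
      (fun x hx => (hu x (Ico_subset_Icc_self hx)).hasDerivWithinAt) le_rfl
      (fun x hx => by simpa using hb x (Ico_subset_Icc_self hx)) φ hφ
    rw [gronwallBound_ε0, sub_zero, Real.norm_eq_abs] at this
    have h2 : L * φ ≤ 1 := by nlinarith [two_pi_le, hφ.1, hφ.2]
    have h3 : rexp (L * φ) ≤ 3 := (exp_le_exp.2 h2).trans exp_one_lt_three.le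
    nlinarith [abs_nonneg (u 0)]
  intro φ hφ
  refine ⟨h1 φ hφ, ?_⟩
  have := mv (C := L * (3 * |u 0|)) hu (fun x hx => (hb x hx).trans (by
    have := h1 x hx
    gcongr)) φ hφ
  linarith

/-- Normalised solutions. -/
def NSol (m δ : ℝ) (X W r : ℝ → ℝ) : Prop :=
  (∀ φ ∈ Icc (0:ℝ) (2 * π), r φ ∈ Ioo 0 δ) ∧
    (∀ φ ∈ Icc (0:ℝ) (2 * π),
      HasDerivAt r ((m * r φ + (r φ) ^ 2 * X φ) / (1 + r φ * W φ)) φ)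

lemma prim {X : ℝ → ℝ} (hX : Continuous X) (φ : ℝ) :
    HasDerivAt (fun u => ∫ x in (0:ℝ)..u, X x) (X φ) φ :=
  intervalIntegral.integral_hasDerivAt_right (hX.intervalIntegrable _ _)
    hX.aestronglyMeasurable.stronglyMeasurableAtFilter hX.continuousAt

lemma mem0 : (0:ℝ) ∈ Icc (0:ℝ) (2 * π) := ⟨le_rfl, by positivity⟩
lemma mem1 : (2 * π:ℝ) ∈ Icc (0:ℝ) (2 * π) := ⟨by positivity, le_rfl⟩

lemma NSol.log {m δ M : ℝ} {X W r : ℝ → ℝ} (h : NSol m δ X W r) 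
    (hWM : ∀ φ, |W φ| ≤ M) (hd : δ * M ≤ 1/2) :
    ∀ φ ∈ Icc (0:ℝ) (2 * π),
      HasDerivAt (fun x => Real.log (r x)) ((m + r φ * X φ) / (1 + r φ * W φ)) φ := by
  intro φ hφ
  have hr := h.1 φ hφ
  have hD := den_pos hr.1.le hr.2.le (hWM φ) hd
  convert (h.2 φ hφ).log hr.1.ne' using 1
  have h1 : r φ ≠ 0 := hr.1.ne'
  have : (1 + r φ * W φ) ≠ 0 := by linarith
  field_simp

lemma keyA {m δ M J : ℝ} {X W r : ℝ → ℝ} (hX : Continuous X) (hXM : ∀ φ, |X φ| ≤ M)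
    (hWM : ∀ φ, |W φ| ≤ M) (hd : δ * M ≤ 1/2) (hJ : J = ∫ φ in (0:ℝ)..(2 * π), X φ)
    (hL : 28 * (|m| + 3 * δ * M) ≤ 1) (h : NSol m δ X W r) :
    |Real.log (r (2 * π)) - Real.log (r 0) - (2 * π * m + r 0 * J)|
      ≤ 336 * M * (1 + 3 * M) * (r 0 * (|m| + r 0)) := by
  have hM : 0 ≤ M := (abs_nonneg _).trans (hXM 0)
  have hr0 := h.1 0 mem0
  have hδ : 0 < δ := hr0.1.trans hr0.2
  have hdM : 0 ≤ δ * M := by positivity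
  have hm := abs_nonneg m
  have h3 : ∀ φ ∈ Icc (0:ℝ) (2 * π), r φ ≤ 3 * r 0 := by
    intro φ hφ
    have := (gron (L := 2 * (|m| + δ * M)) (by positivity) (by linarith) h.2 (fun x hx => by
      have hr := h.1 x hx
      refine (p1 hr.1.le hr.2.le (hXM x) (hWM x) hd).trans ?_
      rw [abs_of_pos hr.1]
      have := hr.1.le
      have := hr.2.le
      gcongr) φ hφ).1
    rwa [abs_of_pos hr0.1, abs_of_pos (h.1 φ hφ).1] at this
  set L := 2 * (|m| + 3 * r 0 * M) with hLdef
  have hr0p := hr0.1.le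
  have hL0 : 0 ≤ L := by positivity
  have hL1 : 7 * L ≤ 1 := by
    have : r 0 * M ≤ δ * M := by have := hr0.2.le; gcongr
    rw [hLdef]; linarith
  have h4 : ∀ φ ∈ Icc (0:ℝ) (2 * π), |r φ - r 0| ≤ 21 * L * r 0 := by
    intro φ hφ
    have := (gron (L := L) hL0 hL1 h.2 (fun x hx => by
      have hr := h.1 x hx
      refine (p1 hr.1.le hr.2.le (hXM x) (hWM x) hd).trans ?_
      rw [abs_of_pos hr.1]
      have := hr.1.le
      have := h3 x hx
      rw [hLdef]
      gcongr) φ hφ).2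
    rwa [abs_of_pos hr0.1] at this
  have h5 := mv (u := fun x => Real.log (r x) - m * x - r 0 * ∫ t in (0:ℝ)..x, X t)
    (u' := fun φ => (m + r φ * X φ) / (1 + r φ * W φ) - m - r 0 * X φ)
    (C := 24 * M * L * r 0)
    (fun φ hφ => by
      have a := ((h.log hWM hd φ hφ).sub ((hasDerivAt_id φ).const_mul m)).sub
        ((prim hX φ).const_mul (r 0))
      rw [mul_one] at a
      exact a)
    (fun φ hφ => by
      have hr := h.1 φ hφ
      have a1 := p3 (m := m) hr.1.le hr.2.le (hXM φ) (hWM φ) hd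
      have a2 : (m + r φ * X φ) / (1 + r φ * W φ) - m - r 0 * X φ
        = ((m + r φ * X φ) / (1 + r φ * W φ) - m - r φ * X φ) + (r φ - r 0) * X φ := by ring
      rw [a2]
      refine (abs_add_le _ _).trans ?_
      have a3 : |(r φ - r 0) * X φ| ≤ 21 * L * r 0 * M := by
        rw [abs_mul]
        have := h4 φ hφ
        have := hXM φ
        gcongr
      have a4 : 2 * (|m| + r φ * M) * (r φ * M) ≤ L * (3 * r 0 * M) := by
        have := h3 φ hφ
        have := hr.1.le
        rw [hLdef]
        gcongr
      nlinarith) (2 * π) mem1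
  simp only [intervalIntegral.integral_same, ← hJ] at h5
  have e : Real.log (r (2 * π)) - Real.log (r 0) - (2 * π * m + r 0 * J)
    = Real.log (r (2 * π)) - m * (2 * π) - r 0 * J - (Real.log (r 0) - m * 0 - r 0 * 0) := by ring
  rw [e]
  refine h5.trans ?_
  have : L ≤ 2 * (1 + 3 * M) * (|m| + r 0) := by
    rw [hLdef]; nlinarith [mul_nonneg hM hm]
  calc 7 * (24 * M * L * r 0) ≤ 7 * (24 * M * (2 * (1 + 3 * M) * (|m| + r 0)) * r 0) := by gcongr
    _ = _ := by ring

lemma keyU {m δ M J : ℝ} {X W r q : ℝ → ℝ} (hX : Continuous X) (hXM : ∀ φ, |X φ| ≤ M)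
    (hWM : ∀ φ, |W φ| ≤ M) (hd : δ * M ≤ 1/2) (hJ : J = ∫ φ in (0:ℝ)..(2 * π), X φ)
    (hL : 28 * (|m| + 3 * δ * M) ≤ 1) (hLJ : 168 * M * (4 * (|m| + 3 * δ * M)) < |J|)
    (h : NSol m δ X W r) (hq : NSol m δ X W q) (hr1 : r (2 * π) = r 0) (hq1 : q (2 * π) = q 0) :
    q 0 = r 0 := by
  have hM : 0 ≤ M := (abs_nonneg _).trans (hXM 0)
  have hr0 := h.1 0 mem0
  have hδ : 0 < δ := hr0.1.trans hr0.2
  have hL0 : 0 ≤ 4 * (|m| + 3 * δ * M) := by positivity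
  have hg := gron (u := fun x => q x - r x) (L := 4 * (|m| + 3 * δ * M)) hL0 (by linarith)
    (fun φ hφ => (hq.2 φ hφ).sub (h.2 φ hφ))
    (fun φ hφ => by
      have a := h.1 φ hφ
      have b := hq.1 φ hφ
      exact p2 a.1.le a.2.le b.1.le b.2.le (hXM φ) (hWM φ) hd)
  have h5 := mv (u := fun x => Real.log (q x) - Real.log (r x) - (q 0 - r 0) * ∫ t in (0:ℝ)..x, X t)
    (u' := fun φ => (m + q φ * X φ) / (1 + q φ * W φ) - (m + r φ * X φ) / (1 + r φ * W φ)
      - (q 0 - r 0) * X φ)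
    (C := 24 * M * (4 * (|m| + 3 * δ * M)) * |q 0 - r 0|)
    (fun φ hφ => ((hq.log hWM hd φ hφ).sub (h.log hWM hd φ hφ)).sub
        ((prim hX φ).const_mul (q 0 - r 0)))
    (fun φ hφ => by
      have a := h.1 φ hφ
      have b := hq.1 φ hφ
      obtain ⟨g1, g2⟩ := hg φ hφ
      refine (p4 (q 0 - r 0) a.1.le a.2.le b.1.le b.2.le (hXM φ) (hWM φ) hd).trans ?_
      calc _ ≤ 21 * (4 * (|m| + 3 * δ * M)) * |q 0 - r 0| * M
            + 4 * (M * (|m| + 3 * δ * M)) * (3 * |q 0 - r 0|) := by gcongr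
        _ = _ := by ring) (2 * π) mem1
  simp only [intervalIntegral.integral_same, ← hJ, hr1, hq1] at h5
  have e : Real.log (q 0) - Real.log (r 0) - (q 0 - r 0) * J
    - (Real.log (q 0) - Real.log (r 0) - (q 0 - r 0) * 0) = - ((q 0 - r 0) * J) := by ring
  rw [e, abs_neg, abs_mul] at h5
  by_contra hne
  have : 0 < |q 0 - r 0| := abs_pos.2 (sub_ne_zero.2 hne)
  nlinarith

/-- Existence of a continuous family of solutions. -/
lemma keyE {m δ M : ℝ} {X W : ℝ → ℝ} (hX : Continuous X) (hW : Continuous W)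
    (hXM : ∀ φ, |X φ| ≤ M) (hδ : 0 < δ)
    (hWM : ∀ φ, |W φ| ≤ M) (hd : δ * M ≤ 1/2) 
    (hL : 100 * (|m| + 3 * δ * M) ≤ 1) :
    ∃ α : ℝ → ℝ → ℝ, (∀ x, 0 < x → 3 * x < δ → α x 0 = x ∧ NSol m δ X W (α x)) ∧
      ContinuousOn (fun x => α x (2 * π)) (Icc 0 δ) := by
  have hM : 0 ≤ M := (abs_nonneg _).trans (hXM 0)
  have hpi := pi_pos
  set c : ℝ → ℝ := fun x => max 0 (min x δ) with hc
  have hc0 : ∀ x, 0 ≤ c x := fun x => le_max_left _ _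
  have hcδ : ∀ x, c x ≤ δ := fun x => max_le hδ.le (min_le_right _ _)
  have hcx : ∀ x, c x ≤ |x| := fun x =>
    max_le (abs_nonneg _) ((min_le_left _ _).trans (le_abs_self _))
  have hcl : ∀ x y, |c x - c y| ≤ |x - y| := fun x y => by
    have a1 := abs_max_sub_max_le_max 0 (min x δ) 0 (min y δ)
    have a2 := abs_min_sub_min_le_max x δ y δ
    rw [sub_self, abs_zero, max_eq_right (abs_nonneg (min x δ - min y δ))] at a1
    rw [sub_self, abs_zero, max_eq_left (abs_nonneg (x - y))] at a2
    exact a1.trans a2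
  have hcid : ∀ x, 0 < x → x < δ → c x = x := fun x h1 h2 => by
    simp [hc, min_eq_left h2.le, max_eq_right h1.le]
  set L : ℝ := 4 * (|m| + 3 * δ * M) with hLd
  have hL0 : 0 ≤ L := by positivity
  set F : ℝ → ℝ → ℝ := fun t x => (m * c x + (c x) ^ 2 * X t) / (1 + c x * W t) with hF
  have hFc : ∀ t x, |F t x| ≤ L * c x := fun t x => by
    refine (p1 (hc0 x) (hcδ x) (hXM t) (hWM t) hd).trans ?_
    have := hc0 x
    have := hcδ x
    have : 2 * (|m| + c x * M) ≤ 2 * (|m| + δ * M) := by gcongr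
    have h2 : 2 * (|m| + δ * M) ≤ L := by
      have : 0 ≤ δ * M := by positivity
      have := abs_nonneg m
      rw [hLd]; linarith
    gcongr
    linarith
  have hPL : IsPicardLindelof F (tmin := -1) (tmax := 2 * π + 1) ⟨0, by constructor <;> linarith⟩
      (0:ℝ) ⟨δ + L * δ * (2 * π + 1), by positivity⟩ ⟨δ, hδ.le⟩ ⟨L * δ, by positivity⟩
      ⟨L, hL0⟩ := by
    refine ⟨fun t _ => ?_, fun x _ => ?_, fun t _ x _ => ?_, ?_⟩
    · refine LipschitzOnWith.of_dist_le_mul fun x _ y _ => ?_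
      rw [Real.dist_eq, Real.dist_eq]
      refine (p2 (hc0 y) (hcδ y) (hc0 x) (hcδ x) (hXM t) (hWM t) hd).trans ?_
      exact mul_le_mul_of_nonneg_left (hcl x y) hL0
    · refine Continuous.continuousOn ?_
      refine Continuous.div (by fun_prop) (by fun_prop) fun t => ?_
      have := den_pos (hc0 x) (hcδ x) (hWM t) hd
      linarith
    · exact (hFc t x).trans (mul_le_mul_of_nonneg_left (hcδ x) hL0)
    · rw [max_eq_left (by simp; linarith)]
      change L * δ * (2 * π + 1 - 0) ≤ δ + L * δ * (2 * π + 1) - δ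
      linarith
  obtain ⟨α, h1, L', h2⟩ := hPL.exists_forall_mem_closedBall_eq_hasDerivWithinAt_lipschitzOnWith
  refine ⟨α, fun x hx hxd => ?_, ?_⟩
  · have hxb : x ∈ Metric.closedBall (0:ℝ) ((⟨δ, hδ.le⟩ : NNReal) : ℝ) := by
      simp only [Metric.mem_closedBall, dist_zero_right, Real.norm_eq_abs]
      rw [abs_of_pos hx]; linarith
    obtain ⟨h3, h4⟩ := h1 x hxb
    have h3' : α x 0 = x := h3
    have h5 : ∀ t ∈ Icc (0:ℝ) (2 * π), HasDerivAt (α x) (F t (α x t)) t := fun t ht =>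
      (h4 t ⟨by linarith [ht.1], by linarith [ht.2]⟩).hasDerivAt
        (Icc_mem_nhds (by linarith [ht.1]) (by linarith [ht.2]))
    have hg := gron (u := α x) hL0 (by rw [hLd]; linarith) h5 (fun t _ =>
      (hFc t _).trans (mul_le_mul_of_nonneg_left (hcx _) hL0))
    rw [h3', abs_of_pos hx] at hg
    have hm : ∀ t ∈ Icc (0:ℝ) (2 * π), α x t ∈ Ioo 0 δ := fun t ht => by
      obtain ⟨a, b⟩ := hg t ht
      have b' := (abs_le.1 b).1
      have : 21 * L * x ≤ 0.84 * x := by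
        gcongr; rw [hLd]; linarith
      exact ⟨by linarith, by linarith [le_abs_self (α x t)]⟩
    refine ⟨h3', hm, fun t ht => ?_⟩
    have := h5 t ht
    simp only [hF] at this
    rwa [hcid _ (hm t ht).1 (hm t ht).2] at this
  · refine (h2 (2 * π) ⟨by linarith, by linarith⟩).continuousOn.mono fun x hx => ?_
    simp only [Metric.mem_closedBall, dist_zero_right, Real.norm_eq_abs]
    rw [abs_of_nonneg hx.1]; exact hx.2

set_option maxHeartbeats 1000000 in
lemma normMain {M J : ℝ} {X W : ℝ → ℝ} (hX : Continuous X) (hW : Continuous W)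
    (hM : 1 ≤ M) (hXM : ∀ φ, |X φ| ≤ M) (hWM : ∀ φ, |W φ| ≤ M)
    (hJ : J = ∫ φ in (0:ℝ)..(2 * π), X φ) (hJ0 : J ≠ 0) :
    ∃ ε > 0, ∃ δ > 0, ∃ C > 0, ∀ m : ℝ, 0 < |m| → |m| < ε →
      ((m * J < 0 → ∃ r, NSol m δ X W r ∧ r (2 * π) = r 0 ∧
          |r 0 + 2 * π * m / J| ≤ C * m ^ 2 ∧
          ∀ q, NSol m δ X W q → q (2 * π) = q 0 → q 0 = r 0) ∧
       (0 < m * J → ¬ ∃ r, NSol m δ X W r ∧ r (2 * π) = r 0)) := by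
  have hJp : 0 < |J| := abs_pos.2 hJ0
  have hpi := pi_pos
  have hpi3 := pi_gt_three
  have h2pi := two_pi_le
  obtain ⟨A, hA⟩ : ∃ A, A = M * (1 + 3 * M) := ⟨_, rfl⟩
  have hA1 : M ≤ A := by nlinarith
  have hA2 : M * M ≤ A := by nlinarith
  have hApos : 0 < A := by linarith
  obtain ⟨δ, hδdef⟩ : ∃ δ, δ = min 1 |J| / (10000 * A) := ⟨_, rfl⟩
  have hδ : 0 < δ := by rw [hδdef]; positivity
  have hδA : δ * A = min 1 |J| / 10000 := by rw [hδdef]; field_simp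
  have hδA1 : δ * A ≤ 1 / 10000 := by rw [hδA]; gcongr; exact min_le_left _ _
  have hδA2 : δ * A ≤ |J| / 10000 := by rw [hδA]; gcongr; exact min_le_right _ _
  have hδM : δ * M ≤ 1 / 10000 := by nlinarith
  have hδM2 : δ * (M * M) ≤ |J| / 10000 := by nlinarith
  obtain ⟨K, hK⟩ : ∃ K, K = 336 * M * (1 + 3 * M) := ⟨_, rfl⟩
  have hKA : K = 336 * A := by rw [hK, hA]; ring
  have hKpos : 0 < K := by rw [hKA]; positivity
  have hKδ1 : K * δ ≤ 1 := by rw [hKA]; nlinarith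
  have hKδ2 : K * δ ≤ |J| / 2 := by rw [hKA]; nlinarith
  refine ⟨min (1/200) (min (|J| / (2000 * M)) (δ * |J| / 42)), by positivity, δ, hδ,
    K * (16 / |J|) * (1 + 16 / |J|) / |J|, by positivity, fun m hm0 hm => ?_⟩
  obtain ⟨hm1, hm23⟩ := lt_min_iff.1 hm
  obtain ⟨hm2, hm3⟩ := lt_min_iff.1 hm23
  rw [lt_div_iff₀ (by positivity)] at hm2 hm3
  have hL100 : 100 * (|m| + 3 * δ * M) ≤ 1 := by linarith
  have hLJ : 168 * M * (4 * (|m| + 3 * δ * M)) < |J| := by nlinarith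
  have hd : δ * M ≤ 1/2 := by linarith
  have key : ∀ r, NSol m δ X W r →
    |Real.log (r (2 * π)) - Real.log (r 0) - (2 * π * m + r 0 * J)| ≤ K * (r 0 * (|m| + r 0)) := by
    intro r hr
    rw [hK]
    exact keyA hX hXM hWM hd hJ (by linarith) hr
  have key2 : ∀ r, NSol m δ X W r → r (2 * π) = r 0 →
      |2 * π * m + r 0 * J| ≤ K * (r 0 * (|m| + r 0)) := by
    intro r hr h1
    have := key r hr
    rwa [h1, sub_self, zero_sub, abs_neg] at this
  constructor
  · intro hmJ
    obtain ⟨ρ, hρd⟩ : ∃ ρ, ρ = -(2 * π * m) / J := ⟨_, rfl⟩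
    have hρJ : ρ * J = - (2 * π * m) := by rw [hρd]; field_simp
    have hρ : 0 < ρ := by
      by_contra hcon
      have b1 : ρ * J * J = - (2 * π) * (m * J) := by rw [hρJ]; ring
      have b2 : 0 < - (2 * π) * (m * J) := mul_pos_of_neg_of_neg (by linarith) hmJ
      have b3 : ρ * (J * J) ≤ 0 :=
        mul_nonpos_of_nonpos_of_nonneg (not_lt.1 hcon) (mul_self_nonneg J)
      linarith
    have hρJ' : ρ * |J| = 2 * π * |m| := by
      rw [← abs_of_pos hρ, ← abs_mul, hρJ, abs_neg, abs_mul, abs_of_pos (by positivity : 0 < 2 * π)]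
    have h7m : 2 * π * |m| ≤ 7 * |m| := by gcongr
    have hρδ : 6 * ρ < δ := by
      have : 6 * ρ * |J| < δ * |J| := by linarith
      exact lt_of_mul_lt_mul_right this hJp.le
    have hE : K * (2 * ρ * (|m| + 2 * ρ)) < π * |m| := by
      have a0 : K * (6 * ρ) ≤ K * δ := by gcongr
      have a1 : K * (6 * ρ) ≤ 1 := a0.trans hKδ1
      have a2 : K * (6 * ρ) ≤ |J| / 2 := a0.trans hKδ2
      have a3 : K * (6 * ρ) * |m| ≤ 1 * |m| := by gcongr
      have a4 : K * (6 * ρ) * ρ ≤ |J| / 2 * ρ := by gcongr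
      have a5 : 3 * |m| < π * |m| := by gcongr
      linarith
    have hE1 : K * (ρ / 2 * (|m| + ρ / 2)) < π * |m| := by
      refine lt_of_le_of_lt ?_ hE
      gcongr <;> linarith
    obtain ⟨α, hα, hαc⟩ := keyE (m := m) hX hW hXM hδ hWM hd hL100
    obtain ⟨i1, s1⟩ := hα (ρ / 2) (by linarith) (by linarith)
    obtain ⟨i2, s2⟩ := hα (2 * ρ) (by linarith) (by linarith)
    have k1 := key _ s1
    have k2 := key _ s2
    rw [i1] at k1
    rw [i2] at k2
    have p1 := (s1.1 _ mem1).1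
    have p2 := (s2.1 _ mem1).1
    have k1' := abs_lt.1 (k1.trans_lt hE1)
    have k2' := abs_lt.1 (k2.trans_lt hE)
    have e1 : 2 * π * m + ρ / 2 * J = π * m := by linarith
    have e2 : 2 * π * m + 2 * ρ * J = - (2 * π * m) := by linarith
    rw [e1] at k1'
    rw [e2] at k2'
    have hzero : (0:ℝ) ∈ uIcc (α (ρ/2) (2 * π) - ρ/2) (α (2 * ρ) (2 * π) - 2 * ρ) := by
      rcases lt_or_gt_of_ne (abs_pos.1 hm0) with hneg | hpos
      · rw [abs_of_neg hneg] at k1' k2'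
        have l1 : α (ρ/2) (2 * π) < ρ / 2 :=
          (Real.log_lt_log_iff p1 (by linarith)).1 (by linarith)
        have l2 : 2 * ρ < α (2 * ρ) (2 * π) :=
          (Real.log_lt_log_iff (by linarith) p2).1 (by linarith)
        exact mem_uIcc.2 (Or.inl ⟨by linarith, by linarith⟩)
      · rw [abs_of_pos hpos] at k1' k2'
        have l1 : ρ / 2 < α (ρ/2) (2 * π) :=
          (Real.log_lt_log_iff (by linarith) p1).1 (by linarith)
        have l2 : α (2 * ρ) (2 * π) < 2 * ρ :=
          (Real.log_lt_log_iff p2 (by linarith)).1 (by linarith)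
        exact mem_uIcc.2 (Or.inr ⟨by linarith, by linarith⟩)
    have hsub : uIcc (ρ / 2) (2 * ρ) ⊆ Icc 0 δ := by
      rw [uIcc_of_le (by linarith)]
      exact Icc_subset_Icc (by linarith) (by linarith)
    obtain ⟨x, hx, hx0⟩ := intermediate_value_uIcc
      (f := fun x => α x (2 * π) - x) ((hαc.mono hsub).sub continuousOn_id) hzero
    rw [uIcc_of_le (by linarith)] at hx
    obtain ⟨i3, s3⟩ := hα x (by linarith [hx.1]) (by linarith [hx.2])
    have hper : α x (2 * π) = α x 0 := by rw [i3]; simp only at hx0; linarith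
    refine ⟨α x, s3, hper, ?_, fun q hq hq1 =>
      keyU hX hXM hWM hd hJ (by linarith) hLJ s3 hq hper hq1⟩
    have k3 := key2 _ s3 hper
    rw [i3] at k3 ⊢
    have hxp : 0 < x := by linarith [hx.1]
    have hx16 : x ≤ 16 / |J| * |m| := by
      rw [div_mul_eq_mul_div, le_div_iff₀ hJp]
      have h7 : x * |J| ≤ 2 * ρ * |J| := by
        have := hx.2
        gcongr
      linarith
    have e : x + 2 * π * m / J = (2 * π * m + x * J) / J := by field_simp; ring
    rw [e, abs_div, div_mul_eq_mul_div]
    gcongr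
    refine k3.trans ?_
    calc K * (x * (|m| + x)) ≤ K * (16 / |J| * |m| * (|m| + 16 / |J| * |m|)) := by gcongr
      _ = K * (16 / |J|) * (1 + 16 / |J|) * |m| ^ 2 := by ring
      _ = _ := by rw [sq_abs]
  · rintro hmJ ⟨r, hr, h1⟩
    have k := key2 r hr h1
    have hr0 := hr.1 0 mem0
    have e : |2 * π * m + r 0 * J| = 2 * π * |m| + r 0 * |J| := by
      have hr0' := hr0.1.le
      rcases lt_or_gt_of_ne hJ0 with hneg | hpos
      · have : m < 0 := by nlinarith
        rw [abs_of_neg hneg, abs_of_neg this, abs_of_nonpos (by nlinarith)]; ring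
      · have : 0 < m := by nlinarith
        rw [abs_of_pos hpos, abs_of_pos this, abs_of_nonneg (by positivity)]
    rw [e] at k
    have a0 : K * r 0 ≤ K * δ := by
      have := hr0.2.le
      gcongr
    have a1 : K * r 0 ≤ 1 := a0.trans hKδ1
    have a2 : K * r 0 ≤ |J| / 2 := a0.trans hKδ2
    have a3 : K * r 0 * |m| ≤ 1 * |m| := by gcongr
    have a4 : K * r 0 * r 0 ≤ |J| / 2 * r 0 := by have := hr0.1.le; gcongr
    have a5 : 3 * |m| < π * |m| := by gcongr
    linarith [mul_pos hr0.1 hJp]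

lemma nsol_iff {ω μ δ : ℝ} (hω : ω ≠ 0) {χ₂ Ω₁ : ℝ → ℝ} {r : ℝ → ℝ} :
    NSol (μ / ω) δ (fun φ => χ₂ φ / ω) (fun φ => Ω₁ φ / ω) r ↔
    (∀ φ ∈ Icc (0:ℝ) (2 * π), r φ ∈ Ioo 0 δ) ∧
    (∀ φ ∈ Icc (0:ℝ) (2 * π),
      HasDerivAt r ((μ * r φ + (r φ) ^ 2 * χ₂ φ) / (ω + r φ * Ω₁ φ)) φ) := by
  have e : ∀ φ, (μ / ω * r φ + (r φ) ^ 2 * (χ₂ φ / ω)) / (1 + r φ * (Ω₁ φ / ω))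
      = (μ * r φ + (r φ) ^ 2 * χ₂ φ) / (ω + r φ * Ω₁ φ) := by
    intro φ
    have e1 : μ / ω * r φ + (r φ) ^ 2 * (χ₂ φ / ω) = (μ * r φ + (r φ) ^ 2 * χ₂ φ) / ω := by ring
    have e2 : 1 + r φ * (Ω₁ φ / ω) = (ω + r φ * Ω₁ φ) / ω := by field_simp
    rw [e1, e2, div_div_div_cancel_right₀ hω]
  simp only [NSol, e]

lemma bdd {f : ℝ → ℝ} (hf : Continuous f) (hp : ∀ φ, f (φ + 2 * π) = f φ) :
    ∃ M, ∀ φ, |f φ| ≤ M := by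
  obtain ⟨M, hM⟩ := (Function.Periodic.isBounded_of_continuous (f := f) hp
    (by positivity) hf).exists_norm_le
  exact ⟨M, fun φ => hM _ ⟨φ, rfl⟩⟩



/-- For `ω ≠ 0` and continuous `2π`-periodic `χ₂, Ω₁` with
`I = ∫₀^{2π} χ₂ ≠ 0`, the radial ODE has, for each small `μ ≠ 0`: a unique positive
periodic radius `r₀ = −(2π/I)μ + O(μ²)` when `μI < 0`, and no positive periodic radius
when `μI > 0`; thus the sign of `I` determines the criticality. -/
theorem stmt2 (ω : ℝ) (hω : ω ≠ 0)
    (χ₂ Ω₁ : ℝ → ℝ) (hχc : Continuous χ₂) (hΩc : Continuous Ω₁)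
    (hχp : ∀ φ, χ₂ (φ + 2 * π) = χ₂ φ) (hΩp : ∀ φ, Ω₁ (φ + 2 * π) = Ω₁ φ)
    (I : ℝ) (hI : I = ∫ φ in (0:ℝ)..(2 * π), χ₂ φ) (hI0 : I ≠ 0) :
    ∃ ε > 0, ∃ δ > 0, ∃ C > 0, ∀ μ : ℝ, 0 < |μ| → |μ| < ε →
      ((μ * I < 0 →
        ∃ r₀ ∈ Ioo (0:ℝ) δ, SolvesRadialBVP ω μ δ χ₂ Ω₁ r₀ ∧
          |r₀ + 2 * π * μ / I| ≤ C * μ ^ 2 ∧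
          ∀ r₀' ∈ Ioo (0:ℝ) δ, SolvesRadialBVP ω μ δ χ₂ Ω₁ r₀' → r₀' = r₀) ∧
       (0 < μ * I →
        ¬ ∃ r₀ ∈ Ioo (0:ℝ) δ, SolvesRadialBVP ω μ δ χ₂ Ω₁ r₀)) := by
  obtain ⟨M1, hM1⟩ := bdd (f := fun φ => χ₂ φ / ω) (by fun_prop) (fun φ => by simp only [hχp])
  obtain ⟨M2, hM2⟩ := bdd (f := fun φ => Ω₁ φ / ω) (by fun_prop) (fun φ => by simp only [hΩp])
  have hJ : I / ω = ∫ φ in (0:ℝ)..(2 * π), χ₂ φ / ω := by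
    rw [intervalIntegral.integral_div, hI]
  have hω' : 0 < |ω| := abs_pos.2 hω
  obtain ⟨ε, hε, δ, hδ, C, hC, H⟩ := normMain (M := max 1 (max M1 M2)) (J := I / ω)
    (X := fun φ => χ₂ φ / ω) (W := fun φ => Ω₁ φ / ω) (by fun_prop) (by fun_prop)
    (le_max_left _ _) (fun φ => (hM1 φ).trans ((le_max_left _ _).trans (le_max_right _ _)))
    (fun φ => (hM2 φ).trans ((le_max_right _ _).trans (le_max_right _ _))) hJ
    (div_ne_zero hI0 hω)
  refine ⟨ε * |ω|, by positivity, δ, hδ, C / ω ^ 2, by positivity, fun μ hμ0 hμ => ?_⟩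
  obtain ⟨h1, h2⟩ := H (μ / ω) (by rw [abs_div]; positivity)
    (by rw [abs_div, div_lt_iff₀ hω']; exact hμ)
  have hs : μ / ω * (I / ω) = μ * I / ω ^ 2 := by field_simp
  have hω2 : 0 < ω ^ 2 := by positivity
  have conv : ∀ r₀, SolvesRadialBVP ω μ δ χ₂ Ω₁ r₀ ↔ ∃ r, NSol (μ / ω) δ
      (fun φ => χ₂ φ / ω) (fun φ => Ω₁ φ / ω) r ∧ r (2 * π) = r 0 ∧ r 0 = r₀ := by
    intro r₀
    constructor
    · rintro ⟨r, a, b, c, d⟩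
      exact ⟨r, (nsol_iff hω).2 ⟨a, b⟩, by rw [c, d], c⟩
    · rintro ⟨r, a, b, c⟩
      obtain ⟨a1, a2⟩ := (nsol_iff hω).1 a
      exact ⟨r, a1, a2, c, by rw [b, c]⟩
  constructor
  · intro hμI
    obtain ⟨r, hr, hp, hb, hu⟩ := h1 (by rw [hs]; exact div_neg_of_neg_of_pos hμI hω2)
    refine ⟨r 0, hr.1 0 mem0, (conv _).2 ⟨r, hr, hp, rfl⟩, ?_, ?_⟩
    · have e1 : 2 * π * (μ / ω) / (I / ω) = 2 * π * μ / I := by field_simp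
      have e2 : C / ω ^ 2 * μ ^ 2 = C * (μ / ω) ^ 2 := by rw [div_pow]; ring
      rw [e2, ← e1]
      exact hb
    · intro r₀' _ h
      obtain ⟨q, hq, hq1, hq0⟩ := (conv _).1 h
      rw [← hq0]
      exact hu q hq hq1
  · rintro hμI ⟨r₀, _, h⟩
    obtain ⟨q, hq, hq1, _⟩ := (conv _).1 h
    exact h2 (by rw [hs]; positivity) ⟨q, hq, hq1⟩
end

section
/- Consider the planar system (P): v' = μv − ωw + f(v,w), w' = ωv + μw + g(v,w), and assume σ_# ≠ 0. Then there exist ε, δ, C > 0 such that for every μ with 0 < |μ| < ε: (i) if μ·σ_# < 0, the system (P) has a nonconstant periodic solution (v,w) : ℝ → ℝ² with 0 < sup_t √(v(t)² + w(t)²) < δ, whose amplitude satisfies |sup_t √(v(t)² + w(t)²) + 3πμ/(2σ_#)| ≤ C·μ², i.e., the leading-order amplitude is r₀(μ) = −(3π/(2σ_#))·μ + O(μ²); any two nonconstant periodic solutions of (P) with supremum norm less than δ coincide up to a time translation; moreover this periodic orbit is orbitally asymptotically stable if μ > 0 and orbitally unstable if μ < 0; (ii) if μ·σ_# > 0, the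 system (P) has no nonconstant periodic solution with supremum norm less than δ. In particular, the degenerate Hopf bifurcation at μ = 0 is subcritical if σ_# > 0 and supercritical if σ_# < 0. -/
open Real Filter Metric Set

/-- A (global) solution of the autonomous planar ODE `u' = F(u)`. -/
def IsSolution2 (F : ℝ × ℝ → ℝ × ℝ) (u : ℝ → ℝ × ℝ) : Prop :=
  ∀ t, HasDerivAt u (F (u t)) t

/-- A nonconstant periodic solution of `u' = F(u)`. -/
def IsPeriodicSolution2 (F : ℝ × ℝ → ℝ × ℝ) (u : ℝ → ℝ × ℝ) : Prop :=
  IsSolution2 F u ∧ (∃ T > 0, ∀ t, u (t + T) = u t) ∧ ¬ (∀ t, u t = u 0)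

/-- The amplitude `sup_t √(v(t)² + w(t)²)` of a planar curve. -/
noncomputable def ampl2 (u : ℝ → ℝ × ℝ) : ℝ :=
  ⨆ t : ℝ, Real.sqrt ((u t).1 ^ 2 + (u t).2 ^ 2)

/-- Orbital (Lyapunov) stability of a set `Γ` for the flow of `F`. -/
def OrbitallyStable2 (F : ℝ × ℝ → ℝ × ℝ) (Γ : Set (ℝ × ℝ)) : Prop :=
  ∀ η > 0, ∃ ζ > 0, ∀ u : ℝ → ℝ × ℝ, IsSolution2 F u →
    infDist (u 0) Γ < ζ → ∀ t ≥ 0, infDist (u t) Γ < η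

/-- Orbital asymptotic stability of a set `Γ` for the flow of `F`. -/
def OrbitallyAsympStable2 (F : ℝ × ℝ → ℝ × ℝ) (Γ : Set (ℝ × ℝ)) : Prop :=
  OrbitallyStable2 F Γ ∧ ∃ ζ > 0, ∀ u : ℝ → ℝ × ℝ, IsSolution2 F u →
    infDist (u 0) Γ < ζ → Tendsto (fun t => infDist (u t) Γ) atTop (nhds 0)



lemma hasDerivAt_comp_neg' {f : ℝ → ℝ} {f' t : ℝ} (h : HasDerivAt f f' (-t)) :
    HasDerivAt (fun s => f (-s)) (-f') t := by
  have := h.comp t (hasDerivAt_neg t)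
  rw [mul_neg_one] at this
  exact this

lemma global_exists (f : ℝ → ℝ → ℝ) (K L : NNReal) (hc : ∀ x, Continuous (fun t => f t x))
    (hK : ∀ t, LipschitzWith K (f t)) (hL : ∀ t x, |f t x| ≤ L) (x0 : ℝ) :
    ∃ x : ℝ → ℝ, x 0 = x0 ∧ ∀ t, HasDerivAt x (f t (x t)) t := by
  have h1 : ∀ n : ℕ, ∃ x : ℝ → ℝ, x 0 = x0 ∧ ∀ t ∈ Ioo (-(n+1:ℝ)) (n+1),
      HasDerivAt x (f t (x t)) t := by
    intro n
    have hn : (0:ℝ) ≤ n := n.cast_nonneg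
    have h0 : (0:ℝ) ∈ Icc (-(n+1:ℝ)) (n+1) := ⟨by linarith, by linarith⟩
    have hp : IsPicardLindelof f (tmin := -(n+1:ℝ)) (tmax := (n+1)) ⟨0, h0⟩ x0
        (L * (n+1)) 0 L K := by
      refine ⟨fun t _ => (hK t).lipschitzOnWith, fun x _ => (hc x).continuousOn,
        fun t _ x _ => by simpa using hL t x, ?_⟩
      simp
    obtain ⟨x, hx0, hx⟩ := hp.exists_eq_forall_mem_Icc_hasDerivWithinAt₀
    refine ⟨x, hx0, fun t ht => ?_⟩
    exact (hx t (Ioo_subset_Icc_self ht)).hasDerivAt (Icc_mem_nhds ht.1 ht.2)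
  choose X hX0 hX using h1
  have hag : ∀ n m : ℕ, n ≤ m → EqOn (X n) (X m) (Ioo (-(n+1:ℝ)) (n+1)) := by
    intro n m hnm
    have hn : (0:ℝ) ≤ n := n.cast_nonneg
    have hnm' : (n:ℝ) ≤ m := by exact_mod_cast hnm
    refine ODE_solution_unique_of_mem_Ioo (v := f) (s := fun _ => univ) (K := K) (t₀ := 0)
      (fun t _ => (hK t).lipschitzOnWith) ⟨by linarith, by linarith⟩
      (fun t ht => ⟨hX n t ht, trivial⟩) (fun t ht => ⟨hX m t ⟨by linarith [ht.1], by linarith [ht.2]⟩, trivial⟩) ?_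
    rw [hX0, hX0]
  refine ⟨fun t => X ⌈|t|⌉₊ t, by simp [hX0], fun t => ?_⟩
  have hmem : ∀ s : ℝ, s ∈ Ioo (-((⌈|s|⌉₊:ℝ)+1)) ((⌈|s|⌉₊:ℝ)+1) := by
    intro s
    have h1 := Nat.le_ceil |s|
    exact ⟨by linarith [neg_abs_le s], by linarith [le_abs_self s]⟩
  have hev : (fun t => X ⌈|t|⌉₊ t) =ᶠ[nhds t] X (⌈|t|⌉₊+1) := by
    have : Ioo (t-1) (t+1) ∈ nhds t := Ioo_mem_nhds (by linarith) (by linarith)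
    filter_upwards [this] with s hs
    apply hag _ _ _ (hmem s)
    apply Nat.ceil_le.2
    push_cast
    have h1 := Nat.le_ceil |t|
    have : |s| ≤ |t| + 1 := by
      have := abs_sub_abs_le_abs_sub s t
      have h2 : |s - t| ≤ 1 := abs_le.2 ⟨by linarith [hs.1], by linarith [hs.2]⟩
      linarith
    linarith
  have hd : HasDerivAt (X (⌈|t|⌉₊+1)) (f t (X (⌈|t|⌉₊+1) t)) t := by
    apply hX
    have := hmem t
    push_cast
    exact ⟨by linarith [this.1], by linarith [this.2]⟩
  have h2 := hd.congr_of_eventuallyEq hev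
  rw [← hev.self_of_nhds] at h2
  exact h2

/-- barrier from above -/
lemma barrier_le (V V' : ℝ → ℝ) (c : ℝ) (hV : ∀ t, HasDerivAt V (V' t) t)
    (h : ∀ t, V t = c → V' t < 0) (t0 : ℝ) (h0 : V t0 ≤ c) : ∀ t ≥ t0, V t ≤ c := by
  intro t ht
  exact image_le_of_deriv_right_lt_deriv_boundary' (f := V) (f' := V') (a := t0) (b := t)
    (B := fun _ => c) (B' := fun _ => 0)
    (fun x _ => (hV x).continuousAt.continuousWithinAt) (fun x _ => (hV x).hasDerivWithinAt)
    h0 continuousOn_const (fun x _ => hasDerivWithinAt_const _ _ _) (fun x _ hx => h x hx)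
    ⟨ht, le_rfl⟩

lemma trapped_periodic (f : ℝ → ℝ → ℝ) (K L : NNReal) (hc : ∀ x, Continuous (fun t => f t x))
    (hK : ∀ t, LipschitzWith K (f t)) (hL : ∀ t x, |f t x| ≤ L) (M : ℝ) (hM : 0 < M)
    (P : ℝ) (hP : 0 < P) (hper : ∀ t x, f (t + P) x = f t x)
    (hu : ∀ t, f t M < 0) (hl : ∀ t, 0 < f t (-M)) :
    ∃ y : ℝ → ℝ, (∀ t, HasDerivAt y (f t (y t)) t) ∧ (∀ t, y (t + P) = y t) ∧
      ∀ t, |y t| ≤ M := by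
  choose φ hφ0 hφ using fun x0 => global_exists f K L hc hK hL x0
  have hup : ∀ x, x ≤ M → ∀ t ≥ 0, φ x t ≤ M := fun x hx =>
    barrier_le (φ x) _ M (hφ x) (fun t ht => by rw [ht]; exact hu t) 0 (by rw [hφ0]; exact hx)
  have hlo : ∀ x, -M ≤ x → ∀ t ≥ 0, -M ≤ φ x t := by
    intro x hx t ht
    have := barrier_le (fun t => - φ x t) _ M (fun t => (hφ x t).neg)
      (fun t ht => by
        have : φ x t = -M := by linarith
        rw [this]; linarith [hl t]) 0 (by rw [hφ0]; linarith) t ht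
    linarith
  have hcont : Continuous (fun x => φ x P) := by
    have : LipschitzWith (Real.toNNReal (exp (K * P))) (fun x => φ x P) := by
      apply LipschitzWith.of_dist_le_mul
      intro x y
      rw [Real.coe_toNNReal _ (exp_pos _).le]
      have := dist_le_of_trajectories_ODE (v := f) (K := K) (a := 0) (b := P)
        (f := φ x) (g := φ y) (δ := dist x y) hK
        (fun t _ => (hφ x t).continuousAt.continuousWithinAt) (fun t _ => (hφ x t).hasDerivWithinAt)
        (fun t _ => (hφ y t).continuousAt.continuousWithinAt) (fun t _ => (hφ y t).hasDerivWithinAt)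
        (by rw [hφ0, hφ0]) P ⟨hP.le, le_rfl⟩
      simp only [sub_zero] at this
      linarith
    exact this.continuous
  have hiv := intermediate_value_Icc' (a := -M) (b := M) (by linarith)
    (f := fun x => φ x P - x) (hcont.sub continuous_id).continuousOn
  have h0 : (0:ℝ) ∈ Icc (φ M P - M) (φ (-M) P - (-M)) :=
    ⟨by linarith [hup M le_rfl P hP.le], by linarith [hlo (-M) le_rfl P hP.le]⟩
  obtain ⟨x, hx, hxP⟩ := hiv h0
  have hxP' : φ x P = x := by simpa [sub_eq_zero] using hxP
  have hpp : (fun t => φ x (t + P)) = φ x := by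
    refine ODE_solution_unique_univ (v := f) (s := fun _ => univ) (K := K) (t₀ := 0)
      (fun t => (hK t).lipschitzOnWith) (fun t => ⟨?_, trivial⟩) (fun t => ⟨hφ x t, trivial⟩) ?_
    · have := (hφ x (t+P)).comp_add_const t P
      rwa [hper] at this
    · simp [hφ0, hxP']
  have hperi : Function.Periodic (φ x) P := fun t => congrFun hpp t
  refine ⟨φ x, hφ x, hperi, fun t => ?_⟩
  obtain ⟨n, hn⟩ := exists_nat_gt (-t / P)
  have hnn : 0 ≤ t + n * P := by
    rw [div_lt_iff₀ hP] at hn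
    linarith
  have := hperi.nat_mul n t
  rw [← this, abs_le]
  exact ⟨hlo x hx.1 _ hnn, hup x hx.2 _ hnn⟩

/-- Version with clamp; `ε = ±1` chooses the direction. -/
lemma trapped_periodic' (f : ℝ → ℝ → ℝ) (K L M : ℝ) (hM : 0 < M)
    (hc : ∀ x, |x| ≤ M → Continuous (fun t => f t x))
    (hK : ∀ t x y, |x| ≤ M → |y| ≤ M → |f t x - f t y| ≤ K * |x - y|)
    (hL : ∀ t x, |x| ≤ M → |f t x| ≤ L)
    (P : ℝ) (hP : 0 < P) (hper : ∀ t x, f (t + P) x = f t x)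
    (h : (∀ t, f t M < 0 ∧ 0 < f t (-M)) ∨ (∀ t, 0 < f t M ∧ f t (-M) < 0)) :
    ∃ y : ℝ → ℝ, (∀ t, HasDerivAt y (f t (y t)) t) ∧ (∀ t, y (t + P) = y t) ∧
      ∀ t, |y t| ≤ M := by
  let cl : ℝ → ℝ := fun x => max (-M) (min M x)
  have hcl : ∀ x, |cl x| ≤ M := by
    intro x; rw [abs_le]
    exact ⟨le_max_left _ _, max_le (by linarith) (min_le_left _ _)⟩
  have hcle : ∀ x, |x| ≤ M → cl x = x := by
    intro x hx; rw [abs_le] at hx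
    simp only [cl]; rw [min_eq_right hx.2, max_eq_right hx.1]
  have hclL : ∀ x y, |cl x - cl y| ≤ |x - y| := by
    intro x y
    simp only [cl]
    refine (abs_max_sub_max_le_max _ _ _ _).trans ?_
    simp only [sub_self, abs_zero]
    refine max_le (abs_nonneg _) ?_
    refine (abs_min_sub_min_le_max _ _ _ _).trans ?_
    simp
  have hK0 : 0 ≤ K := by
    have := (abs_nonneg _).trans (hK 0 M 0 (by rw [abs_of_pos hM]) (by simpa using hM.le))
    simp only [sub_zero, abs_of_pos hM] at this
    exact nonneg_of_mul_nonneg_left this hM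
  have hL0 : 0 ≤ L := (abs_nonneg _).trans (hL 0 0 (by simpa using hM.le))
  have hMM : cl M = M := hcle _ (by rw [abs_of_pos hM])
  have hMM' : cl (-M) = -M := hcle _ (by rw [abs_neg, abs_of_pos hM])
  rcases h with h | h
  · obtain ⟨y, hy, hyp, hyM⟩ := trapped_periodic (fun t x => f t (cl x)) K.toNNReal L.toNNReal
      (fun x => hc _ (hcl x)) (fun t => LipschitzWith.of_dist_le_mul fun x y => by
        rw [Real.coe_toNNReal _ hK0, Real.dist_eq, Real.dist_eq]
        exact (hK t _ _ (hcl x) (hcl y)).trans (mul_le_mul_of_nonneg_left (hclL x y) hK0))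
      (fun t x => by rw [Real.coe_toNNReal _ hL0]; exact hL _ _ (hcl x)) M hM P hP
      (fun t x => hper _ _) (fun t => by simp only [hMM]; exact (h t).1)
      (fun t => by simp only [hMM']; exact (h t).2)
    refine ⟨y, fun t => ?_, hyp, hyM⟩
    have := hy t
    simp only [hcle _ (hyM t)] at this
    exact this
  · have hper' : ∀ t x, f (t - P) x = f t x := fun t x => by
      have := hper (t - P) x
      rw [sub_add_cancel] at this; exact this.symm
    obtain ⟨y, hy, hyp, hyM⟩ := trapped_periodic (fun t x => - f (-t) (cl x)) K.toNNReal L.toNNReal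
      (fun x => ((hc _ (hcl x)).comp continuous_neg).neg)
      (fun t => LipschitzWith.of_dist_le_mul fun x y => by
        rw [Real.coe_toNNReal _ hK0, Real.dist_eq, Real.dist_eq]
        rw [neg_sub_neg, abs_sub_comm]
        exact (hK _ _ _ (hcl x) (hcl y)).trans (mul_le_mul_of_nonneg_left (hclL x y) hK0))
      (fun t x => by rw [Real.coe_toNNReal _ hL0, abs_neg]; exact hL _ _ (hcl x)) M hM P hP
      (fun t x => by
        have : -(t + P) = -t - P := by ring
        rw [this, hper']) (fun t => by simp only [hMM]; linarith [(h (-t)).1])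
      (fun t => by simp only [hMM']; linarith [(h (-t)).2])
    refine ⟨fun t => y (-t), fun t => ?_, fun t => ?_, fun t => hyM _⟩
    · have := hasDerivAt_comp_neg' (hy (-t))
      simp only [hcle _ (hyM (-t)), neg_neg] at this
      exact this
    · have := hyp (-(t+P))
      show y (-(t + P)) = y (-t)
      rw [← this]; congr 1; ring

/-- angle equation -/
lemma angle_pos (Θ : ℝ → ℝ) (hc : Continuous Θ) (a b : ℝ) (ha : 0 < a)
    (hab : ∀ x, a ≤ Θ x ∧ Θ x ≤ b) :
    ∃ (φ : ℝ → ℝ), (∀ t, HasDerivAt φ (Θ (φ t)) t) ∧ Function.Surjective φ ∧ φ 0 = 0 ∧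
      (∀ ψ : ℝ → ℝ, (∀ t, HasDerivAt ψ (Θ (ψ t)) t) → ∃ c, ∀ t, ψ t = φ (t + c)) := by
  have hpos : ∀ x, 0 < Θ x := fun x => ha.trans_le (hab x).1
  have hb : 0 < b := (hpos 0).trans_le (hab 0).2
  have hci : Continuous (fun x => (Θ x)⁻¹) := hc.inv₀ fun x => (hpos x).ne'
  let τ : ℝ → ℝ := fun x => ∫ s in (0:ℝ)..x, (Θ s)⁻¹
  have hτ : ∀ x, HasDerivAt τ (Θ x)⁻¹ x := fun x => (hci.integral_hasStrictDerivAt 0 x).hasDerivAt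
  have hτ0 : τ 0 = 0 := by simp [τ]
  have hmono : StrictMono τ := strictMono_of_deriv_pos fun x => by
    rw [(hτ x).deriv]; exact inv_pos.2 (hpos x)
  have hτc : Continuous τ := continuous_iff_continuousAt.2 fun x => (hτ x).continuousAt
  have hlow : Monotone (fun x => τ x - b⁻¹ * x) := by
    have hd : ∀ x, HasDerivAt (fun x => τ x - b⁻¹ * x) ((Θ x)⁻¹ - b⁻¹ * 1) x := fun x =>
      (hτ x).sub ((hasDerivAt_id x).const_mul _)
    refine monotone_of_deriv_nonneg (fun x => (hd x).differentiableAt) fun x => ?_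
    rw [(hd x).deriv, mul_one, sub_nonneg]
    exact inv_anti₀ (hpos x) (hab x).2
  have hsurj : Function.Surjective τ := by
    have hb' : 0 < b⁻¹ := inv_pos.2 hb
    apply hτc.surjective
    · apply tendsto_atTop_mono' _ _ (tendsto_id.const_mul_atTop hb')
      filter_upwards [eventually_ge_atTop 0] with x hx
      have := hlow hx
      simp only [hτ0, mul_zero, sub_zero] at this
      simp only [id]; linarith
    · apply tendsto_atBot_mono' _ _ (tendsto_id.const_mul_atBot hb')
      filter_upwards [eventually_le_atBot 0] with x hx
      have := hlow hx
      simp only [hτ0, mul_zero, sub_zero] at this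
      simp only [id]; linarith
  let e := hmono.orderIsoOfSurjective τ hsurj
  have he : ∀ x, τ (e.symm x) = x := fun x => e.apply_symm_apply x
  have he' : ∀ x, e.symm (τ x) = x := fun x => e.symm_apply_apply x
  refine ⟨e.symm, fun t => ?_, e.symm.surjective, ?_, ?_⟩
  · have := HasDerivAt.of_local_left_inverse (f := τ) (g := e.symm) (a := t) (f' := (Θ (e.symm t))⁻¹)
      (e.symm.continuous.continuousAt) (hτ _) (inv_ne_zero (hpos _).ne')
      (Eventually.of_forall he)
    rwa [inv_inv] at this
  · have := he' 0
    rwa [hτ0] at this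
  · intro ψ hψ
    have hd : ∀ t, HasDerivAt (fun t => τ (ψ t) - t) 0 t := fun t => by
      have := ((hτ (ψ t)).comp t (hψ t)).sub (hasDerivAt_id t)
      rw [inv_mul_cancel₀ (hpos _).ne', sub_self] at this
      exact this
    refine ⟨τ (ψ 0), fun t => ?_⟩
    have := is_const_of_deriv_eq_zero (fun t => (hd t).differentiableAt) (fun t => (hd t).deriv) t 0
    simp only [sub_zero] at this
    rw [← this, add_sub_cancel, he']

lemma angle_ode (Θ : ℝ → ℝ) (hc : Continuous Θ) (ω : ℝ) (hω : ω ≠ 0)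
    (hab : ∀ x, |Θ x - ω| ≤ |ω| / 2) :
    ∃ (φ : ℝ → ℝ), (∀ t, HasDerivAt φ (Θ (φ t)) t) ∧ Function.Surjective φ ∧ φ 0 = 0 ∧
      (∀ ψ : ℝ → ℝ, (∀ t, HasDerivAt ψ (Θ (ψ t)) t) → ∃ c, ∀ t, ψ t = φ (t + c)) := by
  rcases lt_or_gt_of_ne hω with h | h
  · have hab' : ∀ x, -ω / 2 ≤ - Θ x ∧ - Θ x ≤ -(3 * ω / 2) := fun x => by
      have := abs_le.1 (hab x)
      rw [abs_of_neg h] at this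
      constructor <;> linarith
    obtain ⟨φ, h1, h2, h3, h4⟩ := angle_pos (fun x => - Θ x) hc.neg _ _ (by linarith) hab'
    refine ⟨fun t => φ (-t), fun t => ?_, fun x => ?_, by simpa using h3, fun ψ hψ => ?_⟩
    · have := hasDerivAt_comp_neg' (h1 (-t))
      simpa using this
    · obtain ⟨t, ht⟩ := h2 x
      exact ⟨-t, by simpa using ht⟩
    · obtain ⟨c, hc⟩ := h4 (fun t => ψ (-t)) (fun t => by
        exact hasDerivAt_comp_neg' (hψ (-t)))
      refine ⟨-c, fun t => ?_⟩
      have := hc (-t)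
      simp only [neg_neg] at this
      rw [this]; congr 1; ring
  · refine angle_pos Θ hc (ω/2) (3*ω/2) (by linarith) fun x => ?_
    have := abs_le.1 (hab x)
    rw [abs_of_pos h] at this
    constructor <;> linarith


set_option maxHeartbeats 1000000 in
lemma rho_star (ω : ℝ) (hω : ω ≠ 0) (A B ψ : ℝ → ℝ) (Ab S Ψ : ℝ)
    (hAc : Continuous A) (hBc : Continuous B)
    (hAp : ∀ x, A (x + 2 * π) = A x) (hBp : ∀ x, B (x + 2 * π) = B x)
    (hψp : ∀ x, ψ (x + 2 * π) = ψ x) (hψ : ∀ x, HasDerivAt ψ (A x - Ab) x)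
    (hAS : ∀ x, |A x| ≤ S) (hBS : ∀ x, |B x| ≤ S) (hAbS : |Ab| ≤ S) (hψS : ∀ x, |ψ x| ≤ Ψ)
    (hAb : Ab ≠ 0) :
    ∃ ε > 0, ∃ N > 0, ∀ μ, μ * Ab < 0 → |μ| < ε → 2 * N ≤ -Ab / μ ∧
      ∃ ρ : ℝ → ℝ,
        (∀ x, HasDerivAt ρ (-(μ * ρ x + A x) / (ω + B x / ρ x)) x) ∧
        (∀ x, ρ (x + 2 * π) = ρ x) ∧ (∀ x, |ρ x - (-Ab / μ)| ≤ N) ∧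
        (∀ x, |B x / ρ x| ≤ |ω| / 2) := by
  have hωp : 0 < |ω| := abs_pos.2 hω
  have hAbp : 0 < |Ab| := abs_pos.2 hAb
  have hS : 0 ≤ S := (abs_nonneg _).trans hAbS
  have hΨ : 0 ≤ Ψ := (abs_nonneg _).trans (hψS 0)
  set M : ℝ := (Ψ + 4 * S ^ 2 / |Ab|) / |ω| + 1 with hMdef
  have hM : 0 < M := by positivity
  have hMω : (Ψ + 4 * S ^ 2 / |Ab|) < |ω| * M := by
    rw [hMdef, mul_add, mul_div_cancel₀ _ hωp.ne']; linarith
  set N : ℝ := M + Ψ / |ω| with hN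
  have hNp : 0 < N := by positivity
  refine ⟨|Ab| / (2 * N + 4 * S / |ω| + 1), by positivity, N, hNp, fun μ hμ hμε => ?_⟩
  have hμ0 : μ ≠ 0 := by rintro rfl; simp at hμ
  have hμp : 0 < |μ| := abs_pos.2 hμ0
  set ρ0 : ℝ := -Ab / μ with hρ0
  have hρ0abs : ρ0 = |Ab| / |μ| := by
    rw [hρ0]
    rcases lt_or_gt_of_ne hμ0 with h | h
    · have : 0 < Ab := by nlinarith
      rw [abs_of_neg h, abs_of_pos this, div_neg, neg_div]
    · have : Ab < 0 := by nlinarith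
      rw [abs_of_pos h, abs_of_neg this]
  have hbig : 2 * N + 4 * S / |ω| + 1 < ρ0 := by
    rw [hρ0abs, lt_div_iff₀ hμp]
    rw [lt_div_iff₀ (by positivity)] at hμε
    linarith
  have hSω : 0 ≤ 4 * S / |ω| := by positivity
  have hρ0N : 2 * N ≤ ρ0 := by linarith
  have hρ0p : 0 < ρ0 := by linarith
  have hρ0S : 4 * S ≤ |ω| * ρ0 := by
    have : 4 * S / |ω| ≤ ρ0 := by linarith
    rw [div_le_iff₀ hωp] at this; linarith
  have hμρ0 : μ * ρ0 = -Ab := by rw [hρ0]; field_simp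
  have hψω : ∀ x, |ψ x / ω| ≤ Ψ / |ω| := fun x => by
    rw [abs_div]; gcongr; exact hψS x
  refine ⟨hρ0N, ?_⟩
  let R : ℝ → ℝ → ℝ := fun x y => ρ0 + y - ψ x / ω
  have hR : ∀ x y, |y| ≤ M → |R x y - ρ0| ≤ N := fun x y hy => by
    have : R x y - ρ0 = y - ψ x / ω := by simp only [R]; ring
    rw [this]
    exact (abs_sub _ _).trans (add_le_add hy (hψω x))
  have hRl : ∀ x y, |y| ≤ M → ρ0 / 2 ≤ R x y := fun x y hy => by
    have := abs_le.1 (hR x y hy); linarith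
  have hRu : ∀ x y, |y| ≤ M → R x y ≤ 2 * ρ0 := fun x y hy => by
    have := abs_le.1 (hR x y hy); linarith
  have hRp : ∀ x y, |y| ≤ M → 0 < R x y := fun x y hy => by
    have := hRl x y hy; linarith
  have hBR : ∀ x y, |y| ≤ M → |B x| ≤ |ω| * R x y / 2 := fun x y hy => by
    have h1 := hRl x y hy
    have h2 := hBS x
    nlinarith
  have hBR' : ∀ x y, |y| ≤ M → |B x / R x y| ≤ |ω| / 2 := fun x y hy => by
    rw [abs_div, abs_of_pos (hRp x y hy), div_le_iff₀ (hRp x y hy)]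
    linarith [hBR x y hy]
  set m : ℝ := |ω| * ρ0 / 4 with hm
  have hmp : 0 < m := by positivity
  have hden : ∀ x y, |y| ≤ M → m ≤ |ω * R x y + B x| := fun x y hy => by
    have h1 : |ω * R x y| - |B x| ≤ |ω * R x y + B x| := by
      have := abs_sub_abs_le_abs_sub (ω * R x y) (-B x)
      rwa [abs_neg, sub_neg_eq_add] at this
    rw [abs_mul, abs_of_pos (hRp x y hy)] at h1
    have := hBR x y hy
    have := hRl x y hy
    rw [hm]; nlinarith
  have hden0 : ∀ x y, |y| ≤ M → ω * R x y + B x ≠ 0 := fun x y hy =>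
    abs_pos.1 (hmp.trans_le (hden x y hy))
  have hψc : Continuous ψ := continuous_iff_continuousAt.2 fun x => (hψ x).continuousAt
  let f : ℝ → ℝ → ℝ := fun x y => -((μ * R x y + A x) * R x y / (ω * R x y + B x)) + (A x - Ab) / ω
  obtain ⟨y, hy, hyp, hyM⟩ := trapped_periodic' f
    ((|μ| * |ω| * (2 * ρ0) ^ 2 + |μ| * S * (4 * ρ0) + S ^ 2) / m ^ 2)
    ((|μ| * (2 * ρ0) + S) * (2 * ρ0) / m + 2 * S / |ω|) M hM
    (by
      intro y hy
      have hRc : Continuous (fun x => R x y) := by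
        simp only [R]; fun_prop
      have : ∀ x, ω * R x y + B x ≠ 0 := fun x => hden0 x y hy
      simp only [f]
      exact ((((continuous_const.mul hRc).add hAc).mul hRc).div₀
        ((continuous_const.mul hRc).add hBc) this).neg.add
        ((hAc.sub continuous_const).div_const ω))
    (by
      intro x y1 y2 h1 h2
      have e : f x y1 - f x y2 = -((μ * ω * (R x y1 * R x y2) + μ * B x * (R x y1 + R x y2)
          + A x * B x) / ((ω * R x y1 + B x) * (ω * R x y2 + B x)) * (y1 - y2)) := by
        have d1 := hden0 x y1 h1
        have d2 := hden0 x y2 h2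
        have hy12 : y1 - y2 = R x y1 - R x y2 := by simp only [R]; ring
        rw [hy12]
        simp only [f]
        generalize R x y1 = r1 at *
        generalize R x y2 = r2 at *
        generalize A x = a at *
        generalize B x = b at *
        rw [neg_add_eq_sub, neg_add_eq_sub, sub_sub_sub_cancel_left, div_sub_div _ _ d2 d1,
          mul_comm (ω * r1 + b), div_mul_eq_mul_div, ← neg_div]
        congr 1
        ring
      rw [e, abs_neg, abs_mul]
      refine mul_le_mul_of_nonneg_right ?_ (abs_nonneg _)
      rw [abs_div, abs_mul (ω * R x y1 + B x)]
      have n1 := hRp x y1 h1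
      have n2 := hRp x y2 h2
      have u1 := hRu x y1 h1
      have u2 := hRu x y2 h2
      have t1 : |μ * ω * (R x y1 * R x y2)| ≤ |μ| * |ω| * (2 * ρ0) ^ 2 := by
        rw [abs_mul, abs_mul, abs_of_pos (mul_pos n1 n2), sq]
        gcongr
      have t2 : |μ * B x * (R x y1 + R x y2)| ≤ |μ| * S * (4 * ρ0) := by
        rw [abs_mul, abs_mul, abs_of_pos (add_pos n1 n2)]
        gcongr
        · exact hBS x
        · linarith
      have t3 : |A x * B x| ≤ S ^ 2 := by
        rw [abs_mul, sq]
        exact mul_le_mul (hAS x) (hBS x) (abs_nonneg _) hS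
      have t4 : m ^ 2 ≤ |ω * R x y1 + B x| * |ω * R x y2 + B x| := by
        rw [sq]
        exact mul_le_mul (hden x y1 h1) (hden x y2 h2) hmp.le (abs_nonneg _)
      gcongr
      refine (abs_add_le _ _).trans (add_le_add ((abs_add_le _ _).trans (add_le_add t1 t2)) t3))
    (by
      intro x y hy
      simp only [f]
      refine (abs_add_le _ _).trans ?_
      rw [abs_neg, abs_div, abs_div, abs_mul, abs_of_pos (hRp x y hy)]
      have n1 := hRp x y hy
      have u1 := hRu x y hy
      have d1 := hden x y hy
      have t1 : |μ * R x y + A x| ≤ |μ| * (2 * ρ0) + S := by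
        refine (abs_add_le _ _).trans ?_
        rw [abs_mul, abs_of_pos n1]
        gcongr
        exact hAS x
      have t2 : |A x - Ab| ≤ 2 * S := (abs_sub _ _).trans (by linarith [hAS x])
      gcongr)
    (2 * π) (by positivity)
    (by
      intro x y
      simp only [f, R, hAp, hBp, hψp])
    (by
      have key : ∀ x y, |y| ≤ M → f x y = (-(μ * ω * y) + (μ * ψ x + (A x - Ab) * (B x / R x y)))
          / (ω * (ω + B x / R x y)) := fun x y hy => by
        have n1 := hRp x y hy
        have d1 := hden0 x y hy
        have e1 : μ * R x y = -Ab + μ * y - μ * (ψ x / ω) := by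
          simp only [R]; rw [mul_sub, mul_add, hμρ0]
        have e2 : ω + B x / R x y = (ω * R x y + B x) / R x y := by field_simp
        simp only [f]
        rw [e1, e2]
        generalize R x y = r at *
        field_simp
        ring
      have hdp : ∀ x y, |y| ≤ M → 0 < ω * (ω + B x / R x y) := fun x y hy => by
        have h1 := hBR' x y hy
        have h2 : |ω * (B x / R x y)| ≤ |ω| * (|ω| / 2) := by
          rw [abs_mul]; gcongr
        have h3 := abs_le.1 h2
        have h4 : ω * ω = |ω| * |ω| := (abs_mul_abs_self ω).symm
        nlinarith
      have hen : ∀ x y, |y| ≤ M → |μ * ψ x + (A x - Ab) * (B x / R x y)| < |μ| * (|ω| * M) :=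
        fun x y hy => by
        have h1 : |μ * ψ x| ≤ |μ| * Ψ := by rw [abs_mul]; gcongr; exact hψS x
        have t2 : |A x - Ab| ≤ 2 * S := (abs_sub _ _).trans (by linarith [hAS x])
        have t3 : |B x / R x y| ≤ S / (ρ0 / 2) := by
          rw [abs_div, abs_of_pos (hRp x y hy)]
          have := hRl x y hy
          gcongr
          exact hBS x
        have h2 : |(A x - Ab) * (B x / R x y)| ≤ 2 * S * (S / (ρ0 / 2)) := by
          rw [abs_mul]; gcongr
        have h3 : 2 * S * (S / (ρ0 / 2)) = |μ| * (4 * S ^ 2 / |Ab|) := by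
          rw [hρ0abs]; field_simp; ring
        have h4 := abs_add_le (μ * ψ x) ((A x - Ab) * (B x / R x y))
        nlinarith [mul_lt_mul_of_pos_left hMω hμp]
      have hMa : |M| ≤ M := by rw [abs_of_pos hM]
      have hMa' : |-M| ≤ M := by rw [abs_neg, abs_of_pos hM]
      rcases lt_or_gt_of_ne (mul_ne_zero hμ0 hω) with h | h
      · right
        have hab : |μ| * (|ω| * M) = -(μ * ω * M) := by
          rw [← mul_assoc, ← abs_mul, abs_of_neg h]; ring
        intro x
        have e1 := abs_lt.1 (hen x M hMa)
        have e2 := abs_lt.1 (hen x (-M) hMa')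
        rw [key x M hMa, key x (-M) hMa']
        exact ⟨div_pos (by linarith) (hdp _ _ hMa), div_neg_of_neg_of_pos (by linarith) (hdp _ _ hMa')⟩
      · left
        have hab : |μ| * (|ω| * M) = (μ * ω * M) := by
          rw [← mul_assoc, ← abs_mul, abs_of_pos h]
        intro x
        have e1 := abs_lt.1 (hen x M hMa)
        have e2 := abs_lt.1 (hen x (-M) hMa')
        rw [key x M hMa, key x (-M) hMa']
        exact ⟨div_neg_of_neg_of_pos (by linarith) (hdp _ _ hMa), div_pos (by linarith) (hdp _ _ hMa')⟩)
  refine ⟨fun x => R x (y x), fun x => ?_, fun x => ?_, fun x => hR x _ (hyM x),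
    fun x => hBR' x _ (hyM x)⟩
  · have h1 : HasDerivAt (fun x => R x (y x)) (f x (y x) - (A x - Ab) / ω) x :=
      ((hy x).const_add ρ0).sub ((hψ x).div_const ω)
    convert h1 using 1
    have n1 := hRp x _ (hyM x)
    have d1 := hden0 x _ (hyM x)
    have e2 : ω + B x / R x (y x) = (ω * R x (y x) + B x) / R x (y x) := by field_simp
    simp only [f]
    rw [e2]
    generalize R x (y x) = r at *
    field_simp
    ring
  · simp only [R, hyp, hψp]


lemma eq_zero_of_deriv_bound (E E' k : ℝ → ℝ) (hE : ∀ t, HasDerivAt E (E' t) t)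
    (hk : Continuous k) (hb : ∀ t, |E' t| ≤ k t * |E t|) (t0 : ℝ) (h0 : E t0 = 0) :
    ∀ t, E t = 0 := by
  have fw : ∀ (E E' k : ℝ → ℝ) (_ : ∀ t, HasDerivAt E (E' t) t)
      (_ : Continuous k) (_ : ∀ t, |E' t| ≤ k t * |E t|) (t0 : ℝ) (_ : E t0 = 0),
      ∀ t ≥ t0, E t = 0 := by
    intro E E' k hE hk hb t0 h0 t ht
    obtain ⟨K, hK⟩ := (isCompact_Icc (a := t0) (b := t)).bddAbove_image hk.continuousOn
    refine eq_zero_of_abs_deriv_le_mul_abs_self_of_eq_zero_right (f := E) (f' := E') (K := K)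
      (a := t0) (b := t) (fun x _ => (hE x).continuousAt.continuousWithinAt)
      (fun x _ => (hE x).hasDerivWithinAt) h0 (fun x hx => ?_) t ⟨ht, le_rfl⟩
    refine (hb x).trans ?_
    exact mul_le_mul_of_nonneg_right (hK ⟨x, ⟨hx.1, hx.2.le⟩, rfl⟩) (abs_nonneg _)
  intro t
  rcases le_total t0 t with h | h
  · exact fw E E' k hE hk hb t0 h0 t h
  · have := fw (fun s => E (-s)) (fun s => - E' (-s)) (fun s => k (-s))
      (fun s => by
        have := (hE (-s)).comp s (hasDerivAt_neg s)
        rw [mul_neg_one] at this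
        exact this) (hk.comp continuous_neg)
      (fun s => by rw [abs_neg]; exact hb (-s)) (-t0) (by simpa using h0) (-t) (by linarith)
    simpa using this

/-- the planar field -/
def PF (ω : ℝ) (f g : ℝ → ℝ → ℝ) (μ : ℝ) (p : ℝ × ℝ) : ℝ × ℝ :=
  (μ * p.1 - ω * p.2 + f p.1 p.2, ω * p.1 + μ * p.2 + g p.1 p.2)

noncomputable def AA (f g : ℝ → ℝ → ℝ) (x : ℝ) : ℝ :=
  cos x * f (cos x) (sin x) + sin x * g (cos x) (sin x)

noncomputable def BB (f g : ℝ → ℝ → ℝ) (x : ℝ) : ℝ :=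
  cos x * g (cos x) (sin x) - sin x * f (cos x) (sin x)

lemma sol_comp {ω : ℝ} {f g : ℝ → ℝ → ℝ} {μ : ℝ} {u : ℝ → ℝ × ℝ}
    (hu : IsSolution2 (PF ω f g μ) u) (t : ℝ) :
    HasDerivAt (fun t => (u t).1) (μ * (u t).1 - ω * (u t).2 + f (u t).1 (u t).2) t ∧
    HasDerivAt (fun t => (u t).2) (ω * (u t).1 + μ * (u t).2 + g (u t).1 (u t).2) t := by
  exact ⟨(hu t).fst, (hu t).snd⟩

lemma sol_zero {ω : ℝ} {f g : ℝ → ℝ → ℝ} {S : ℝ} {μ : ℝ} {u : ℝ → ℝ × ℝ}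
    (hfS : ∀ v w, |f v w| ≤ S * (v ^ 2 + w ^ 2)) (hgS : ∀ v w, |g v w| ≤ S * (v ^ 2 + w ^ 2))
    (hu : IsSolution2 (PF ω f g μ) u) (t0 : ℝ) (h0 : u t0 = 0) : ∀ t, u t = 0 := by
  have huc : Continuous u := continuous_iff_continuousAt.2 fun t => (hu t).continuousAt
  have h := eq_zero_of_deriv_bound (fun t => (u t).1 ^ 2 + (u t).2 ^ 2)
    (fun t => 2 * μ * ((u t).1 ^ 2 + (u t).2 ^ 2)
      + 2 * ((u t).1 * f (u t).1 (u t).2 + (u t).2 * g (u t).1 (u t).2))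
    (fun t => 2 * |μ| + 2 * (|(u t).1| * S + |(u t).2| * S))
    (fun t => by
      obtain ⟨h1, h2⟩ := sol_comp hu t
      refine ((h1.pow 2).add (h2.pow 2)).congr_deriv ?_
      push_cast
      ring)
    (by fun_prop)
    (fun t => by
      have e : |(u t).1 ^ 2 + (u t).2 ^ 2| = (u t).1 ^ 2 + (u t).2 ^ 2 := abs_of_nonneg (by positivity)
      rw [e]
      set Q := (u t).1 ^ 2 + (u t).2 ^ 2 with hQ
      have hQ0 : 0 ≤ Q := by positivity
      have t1 : |2 * μ * Q| = 2 * |μ| * Q := by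
        rw [abs_mul, abs_mul, abs_of_nonneg hQ0]; norm_num
      have t2 : |(u t).1 * f (u t).1 (u t).2| ≤ |(u t).1| * (S * Q) := by
        rw [abs_mul]; exact mul_le_mul_of_nonneg_left (hfS _ _) (abs_nonneg _)
      have t3 : |(u t).2 * g (u t).1 (u t).2| ≤ |(u t).2| * (S * Q) := by
        rw [abs_mul]; exact mul_le_mul_of_nonneg_left (hgS _ _) (abs_nonneg _)
      refine (abs_add_le _ _).trans ?_
      rw [t1, abs_mul, abs_of_pos (two_pos : (0:ℝ) < 2)]
      have := abs_add_le ((u t).1 * f (u t).1 (u t).2) ((u t).2 * g (u t).1 (u t).2)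
      nlinarith)
    t0 (by simp [h0])
  intro t
  have ht := h t
  have h1 : (u t).1 = 0 := by nlinarith [sq_nonneg (u t).1, sq_nonneg (u t).2]
  have h2 : (u t).2 = 0 := by nlinarith [sq_nonneg (u t).1, sq_nonneg (u t).2]
  exact Prod.ext h1 h2

lemma polar_lift {ω : ℝ} {f g : ℝ → ℝ → ℝ} {μ : ℝ} {u : ℝ → ℝ × ℝ}
    (hf : ∀ r v w, 0 ≤ r → f (r * v) (r * w) = r ^ 2 * f v w)
    (hg : ∀ r v w, 0 ≤ r → g (r * v) (r * w) = r ^ 2 * g v w)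
    (hfc : Continuous (Function.uncurry f)) (hgc : Continuous (Function.uncurry g))
    (hu : IsSolution2 (PF ω f g μ) u) (hne : ∀ t, u t ≠ 0) (r0 x0 : ℝ) (hr0 : 0 < r0)
    (h0 : u 0 = (r0 * cos x0, r0 * sin x0)) :
    ∃ r x : ℝ → ℝ, r 0 = r0 ∧ x 0 = x0 ∧ (∀ t, 0 < r t) ∧
      (∀ t, u t = (r t * cos (x t), r t * sin (x t))) ∧
      (∀ t, HasDerivAt r (μ * r t + r t ^ 2 * AA f g (x t)) t) ∧
      (∀ t, HasDerivAt x (ω + r t * BB f g (x t)) t) := by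
  have huc : Continuous u := continuous_iff_continuousAt.2 fun t => (hu t).continuousAt
  let z : ℝ → ℂ := fun t => ⟨(u t).1, (u t).2⟩
  let z' : ℝ → ℂ := fun t => ⟨(PF ω f g μ (u t)).1, (PF ω f g μ (u t)).2⟩
  have hz : ∀ t, HasDerivAt z (z' t) t := fun t => by
    obtain ⟨h1, h2⟩ := sol_comp hu t
    have := (h1.ofReal_comp).add ((h2.ofReal_comp).mul_const Complex.I)
    have hzz : z = fun t => (((u t).1 : ℝ) : ℂ) + ((u t).2 : ℝ) * Complex.I := by
      ext t; exact Complex.mk_eq_add_mul_I _ _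
    rw [hzz]
    exact this.congr_deriv (Complex.mk_eq_add_mul_I _ _).symm
  have hz0 : ∀ t, z t ≠ 0 := fun t h => hne t (by
    have h1 := congrArg Complex.re h
    have h2 := congrArg Complex.im h
    exact Prod.ext h1 h2)
  have hzc : Continuous z := continuous_iff_continuousAt.2 fun t => (hz t).continuousAt
  have hfu : Continuous (fun t => f (u t).1 (u t).2) :=
    hfc.comp ((continuous_fst.comp huc).prodMk (continuous_snd.comp huc))
  have hgu : Continuous (fun t => g (u t).1 (u t).2) :=
    hgc.comp ((continuous_fst.comp huc).prodMk (continuous_snd.comp huc))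
  have hzc' : Continuous z' := by
    have : z' = fun t => (((PF ω f g μ (u t)).1 : ℝ) : ℂ) + ((PF ω f g μ (u t)).2 : ℝ) * Complex.I := by
      ext t; simp [z', Complex.mk_eq_add_mul_I]
    rw [this]
    simp only [PF]
    fun_prop
  have hqc : Continuous (fun t => z' t / z t) := hzc'.div₀ hzc hz0
  let L : ℝ → ℂ := fun t => ((Real.log r0 : ℝ) + x0 * Complex.I) + ∫ s in (0:ℝ)..t, z' s / z s
  have hL : ∀ t, HasDerivAt L (z' t / z t) t := fun t =>
    ((hqc.integral_hasStrictDerivAt 0 t).hasDerivAt).const_add _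
  have hL0 : L 0 = ((Real.log r0 : ℝ) + x0 * Complex.I) := by simp [L]
  have hexp0 : Complex.exp (L 0) = z 0 := by
    rw [hL0, Complex.exp_add, ← Complex.ofReal_exp, Real.exp_log hr0, Complex.exp_mul_I]
    simp only [z, h0]
    apply Complex.ext <;> simp [-Complex.ofReal_cos, -Complex.ofReal_sin, Complex.cos_ofReal_re, Complex.sin_ofReal_re]
  have hd : ∀ t, HasDerivAt (fun t => z t * Complex.exp (-L t)) 0 t := fun t => by
    have := (hz t).mul ((hL t).neg.cexp)
    refine this.congr_deriv ?_
    have := hz0 t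
    simp only [Pi.neg_apply]
    field_simp
    ring
  have hexp : ∀ t, z t = Complex.exp (L t) := fun t => by
    have := is_const_of_deriv_eq_zero (fun t => (hd t).differentiableAt) (fun t => (hd t).deriv) t 0
    rw [← hexp0, ← Complex.exp_add, add_neg_cancel, Complex.exp_zero, Complex.exp_neg] at this
    exact (mul_inv_eq_one₀ (Complex.exp_ne_zero _)).1 this
  have hv : ∀ t, (u t).1 = Real.exp (L t).re * cos (L t).im := fun t => by
    have := congrArg Complex.re (hexp t)
    rw [Complex.exp_re] at this
    exact this
  have hw : ∀ t, (u t).2 = Real.exp (L t).re * sin (L t).im := fun t => by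
    have := congrArg Complex.im (hexp t)
    rw [Complex.exp_im] at this
    exact this
  have hre : ∀ t, HasDerivAt (fun t => (L t).re) (z' t / z t).re t := fun t =>
    (Complex.reCLM.hasFDerivAt.comp_hasDerivAt t (hL t))
  have him : ∀ t, HasDerivAt (fun t => (L t).im) (z' t / z t).im t := fun t =>
    (Complex.imCLM.hasFDerivAt.comp_hasDerivAt t (hL t))
  refine ⟨fun t => Real.exp (L t).re, fun t => (L t).im, ?_, ?_, fun t => Real.exp_pos _,
    fun t => Prod.ext (hv t) (hw t), fun t => ?_, fun t => ?_⟩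
  · simp [hL0, Real.exp_log hr0]
  · simp [hL0]
  · refine (hre t).exp.congr_deriv ?_
    symm
    have hr := Real.exp_pos (L t).re
    rw [Complex.div_re]
    simp only [z, z', PF, Complex.normSq_mk]
    rw [hv t, hw t, hf _ _ _ hr.le, hg _ _ _ hr.le]
    simp only [AA]
    generalize Real.exp (L t).re = r at *
    have hcs := Real.sin_sq_add_cos_sq (L t).im
    generalize f (cos (L t).im) (sin (L t).im) = F
    generalize g (cos (L t).im) (sin (L t).im) = G
    generalize cos (L t).im = c at *
    generalize sin (L t).im = s at *
    have hn : r * c * (r * c) + r * s * (r * s) = r ^ 2 := by linear_combination r ^ 2 * hcs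
    rw [hn]
    field_simp
    linear_combination (- μ) * hcs
  · refine (him t).congr_deriv ?_
    symm
    have hr := Real.exp_pos (L t).re
    rw [Complex.div_im]
    simp only [z, z', PF, Complex.normSq_mk]
    rw [hv t, hw t, hf _ _ _ hr.le, hg _ _ _ hr.le]
    simp only [BB]
    generalize Real.exp (L t).re = r at *
    have hcs := Real.sin_sq_add_cos_sq (L t).im
    generalize f (cos (L t).im) (sin (L t).im) = F
    generalize g (cos (L t).im) (sin (L t).im) = G
    generalize cos (L t).im = c at *
    generalize sin (L t).im = s at *
    have hn : r * c * (r * c) + r * s * (r * s) = r ^ 2 := by linear_combination r ^ 2 * hcs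
    rw [hn]
    field_simp
    linear_combination (- ω) * hcs

lemma exists_polar (p : ℝ × ℝ) (hp : p ≠ 0) :
    ∃ r x : ℝ, 0 < r ∧ p = (r * cos x, r * sin x) := by
  let z : ℂ := ⟨p.1, p.2⟩
  have hz : z ≠ 0 := fun h => hp (Prod.ext (congrArg Complex.re h) (congrArg Complex.im h))
  refine ⟨‖z‖, z.arg, norm_pos_iff.2 hz, Prod.ext ?_ ?_⟩
  · exact (Complex.norm_mul_cos_arg z).symm
  · exact (Complex.norm_mul_sin_arg z).symm

lemma polar_sol {ω : ℝ} {f g : ℝ → ℝ → ℝ} {μ : ℝ} (r x : ℝ → ℝ)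
    (hf : ∀ r v w, 0 ≤ r → f (r * v) (r * w) = r ^ 2 * f v w)
    (hg : ∀ r v w, 0 ≤ r → g (r * v) (r * w) = r ^ 2 * g v w)
    (hr : ∀ t, 0 < r t)
    (hr' : ∀ t, HasDerivAt r (μ * r t + r t ^ 2 * AA f g (x t)) t)
    (hx' : ∀ t, HasDerivAt x (ω + r t * BB f g (x t)) t) :
    IsSolution2 (PF ω f g μ) (fun t => (r t * cos (x t), r t * sin (x t))) := by
  intro t
  have h1 := (hr' t).mul (hx' t).cos
  have h2 := (hr' t).mul (hx' t).sin
  have h := h1.prodMk h2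
  refine h.congr_deriv ?_
  symm
  simp only [PF, hf _ _ _ (hr t).le, hg _ _ _ (hr t).le, AA, BB]
  have hcs := Real.sin_sq_add_cos_sq (x t)
  generalize f (cos (x t)) (sin (x t)) = F
  generalize g (cos (x t)) (sin (x t)) = G
  generalize cos (x t) = c at *
  generalize sin (x t) = s at *
  refine Prod.ext ?_ ?_
  · simp only; linear_combination (-(r t)^2 * F) * hcs
  · simp only; linear_combination (-(r t)^2 * G) * hcs

lemma polar_unique {r1 r2 x1 x2 : ℝ} (h1 : 0 < r1) (h2 : 0 < r2)
    (h : ((r1 * cos x1, r1 * sin x1) : ℝ × ℝ) = (r2 * cos x2, r2 * sin x2)) :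
    r1 = r2 ∧ ∃ k : ℤ, x1 = x2 + k * (2 * π) := by
  have ha : r1 * cos x1 = r2 * cos x2 := congrArg Prod.fst h
  have hb : r1 * sin x1 = r2 * sin x2 := congrArg Prod.snd h
  have hr : r1 = r2 := by
    have e1 := Real.sin_sq_add_cos_sq x1
    have e2 := Real.sin_sq_add_cos_sq x2
    have : r1 ^ 2 = r2 ^ 2 := by
      calc r1 ^ 2 = (r1 * cos x1) ^ 2 + (r1 * sin x1) ^ 2 := by linear_combination (-r1^2) * e1
        _ = (r2 * cos x2) ^ 2 + (r2 * sin x2) ^ 2 := by rw [ha, hb]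
        _ = r2 ^ 2 := by linear_combination (r2^2) * e2
    exact (pow_left_inj₀ h1.le h2.le two_ne_zero).1 this
  refine ⟨hr, ?_⟩
  subst hr
  have hc := mul_left_cancel₀ h1.ne' ha
  have hs := mul_left_cancel₀ h1.ne' hb
  obtain ⟨k, hk⟩ := Real.Angle.angle_eq_iff_two_pi_dvd_sub.1 (Real.Angle.cos_sin_inj hc hs)
  exact ⟨k, by linear_combination hk⟩


/-- quadratic modulus form -/
noncomputable def qq (a b c d v w : ℝ) : ℝ := a * v * |v| + b * v * |w| + c * w * |v| + d * w * |w|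

lemma qq_hom (a b c d r v w : ℝ) (hr : 0 ≤ r) : qq a b c d (r * v) (r * w) = r ^ 2 * qq a b c d v w := by
  simp only [qq, abs_mul, abs_of_nonneg hr]; ring

lemma qq_cont (a b c d : ℝ) : Continuous (Function.uncurry (qq a b c d)) := by
  have : Function.uncurry (qq a b c d) = fun p : ℝ × ℝ => a * p.1 * |p.1| + b * p.1 * |p.2| + c * p.2 * |p.1| + d * p.2 * |p.2| := by
    ext p; rfl
  rw [this]; fun_prop

lemma qq_bound (a b c d v w : ℝ) : |qq a b c d v w| ≤ (|a| + |b| + |c| + |d|) * (v ^ 2 + w ^ 2) := by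
  have h1 : abs (a * v * |v|) ≤ |a| * (v ^ 2 + w ^ 2) := by
    rw [abs_mul, abs_mul, abs_abs, mul_assoc, ← sq, sq_abs]
    gcongr; nlinarith [sq_nonneg w]
  have h2 : abs (b * v * |w|) ≤ |b| * (v ^ 2 + w ^ 2) := by
    rw [abs_mul, abs_mul, abs_abs, mul_assoc]
    gcongr; nlinarith [sq_nonneg (|v| - |w|), sq_abs v, sq_abs w]
  have h3 : abs (c * w * |v|) ≤ |c| * (v ^ 2 + w ^ 2) := by
    rw [abs_mul, abs_mul, abs_abs, mul_assoc]
    gcongr; nlinarith [sq_nonneg (|v| - |w|), sq_abs v, sq_abs w]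
  have h4 : abs (d * w * |w|) ≤ |d| * (v ^ 2 + w ^ 2) := by
    rw [abs_mul, abs_mul, abs_abs, mul_assoc, ← sq, sq_abs]
    gcongr; nlinarith [sq_nonneg v]
  simp only [qq]
  have e1 := abs_add_le (a * v * |v| + b * v * |w| + c * w * |v|) (d * w * |w|)
  have e2 := abs_add_le (a * v * |v| + b * v * |w|) (c * w * |v|)
  have e3 := abs_add_le (a * v * |v|) (b * v * |w|)
  linarith

lemma AA_cont {f g : ℝ → ℝ → ℝ} (hfc : Continuous (Function.uncurry f))
    (hgc : Continuous (Function.uncurry g)) : Continuous (AA f g) := by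
  have h1 : Continuous (fun x => f (cos x) (sin x)) := hfc.comp (continuous_cos.prodMk continuous_sin)
  have h2 : Continuous (fun x => g (cos x) (sin x)) := hgc.comp (continuous_cos.prodMk continuous_sin)
  unfold AA; fun_prop

lemma BB_cont {f g : ℝ → ℝ → ℝ} (hfc : Continuous (Function.uncurry f))
    (hgc : Continuous (Function.uncurry g)) : Continuous (BB f g) := by
  have h1 : Continuous (fun x => f (cos x) (sin x)) := hfc.comp (continuous_cos.prodMk continuous_sin)
  have h2 : Continuous (fun x => g (cos x) (sin x)) := hgc.comp (continuous_cos.prodMk continuous_sin)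
  unfold BB; fun_prop

lemma AA_per (f g : ℝ → ℝ → ℝ) (x : ℝ) : AA f g (x + 2 * π) = AA f g x := by simp [AA]
lemma BB_per (f g : ℝ → ℝ → ℝ) (x : ℝ) : BB f g (x + 2 * π) = BB f g x := by simp [BB]

lemma AA_bound {f g : ℝ → ℝ → ℝ} {S : ℝ} (hfS : ∀ v w, |f v w| ≤ S * (v ^ 2 + w ^ 2))
    (hgS : ∀ v w, |g v w| ≤ S * (v ^ 2 + w ^ 2)) (x : ℝ) : |AA f g x| ≤ 2 * S := by
  have h1 := hfS (cos x) (sin x)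
  have h2 := hgS (cos x) (sin x)
  rw [Real.cos_sq_add_sin_sq, mul_one] at h1 h2
  simp only [AA]
  refine (abs_add_le _ _).trans ?_
  rw [abs_mul, abs_mul]
  have h3 := mul_le_of_le_one_left (abs_nonneg (f (cos x) (sin x))) (abs_cos_le_one x)
  have h4 := mul_le_of_le_one_left (abs_nonneg (g (cos x) (sin x))) (abs_sin_le_one x)
  linarith

lemma BB_bound {f g : ℝ → ℝ → ℝ} {S : ℝ} (hfS : ∀ v w, |f v w| ≤ S * (v ^ 2 + w ^ 2))
    (hgS : ∀ v w, |g v w| ≤ S * (v ^ 2 + w ^ 2)) (x : ℝ) : |BB f g x| ≤ 2 * S := by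
  have h1 := hfS (cos x) (sin x)
  have h2 := hgS (cos x) (sin x)
  rw [Real.cos_sq_add_sin_sq, mul_one] at h1 h2
  simp only [BB]
  refine (abs_sub _ _).trans ?_
  rw [abs_mul, abs_mul]
  have h3 := mul_le_of_le_one_left (abs_nonneg (g (cos x) (sin x))) (abs_cos_le_one x)
  have h4 := mul_le_of_le_one_left (abs_nonneg (f (cos x) (sin x))) (abs_sin_le_one x)
  linarith

section
variable (a11 a12 a21 a22 b11 b12 b21 b22 : ℝ)

noncomputable def GG (s1 s2 x : ℝ) : ℝ :=
  a11 * s1 * (sin x - sin x ^ 3 / 3) + (a12 * s2 + (a21 + b11) * s1) * (- cos x ^ 3 / 3)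
    + ((a22 + b12) * s2 + b21 * s1) * (sin x ^ 3 / 3) + b22 * s2 * (- cos x + cos x ^ 3 / 3)

lemma quarter (s1 s2 p q : ℝ) (hpq : p ≤ q)
    (h1 : ∀ x ∈ Icc p q, |cos x| = s1 * cos x) (h2 : ∀ x ∈ Icc p q, |sin x| = s2 * sin x) :
    ∫ x in p..q, AA (qq a11 a12 a21 a22) (qq b11 b12 b21 b22) x =
      GG a11 a12 a21 a22 b11 b12 b21 b22 s1 s2 q - GG a11 a12 a21 a22 b11 b12 b21 b22 s1 s2 p := by
  apply intervalIntegral.integral_eq_sub_of_hasDerivAt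
  · intro x hx
    rw [uIcc_of_le hpq] at hx
    have hs := hasDerivAt_sin x
    have hc := hasDerivAt_cos x
    have := (((hs.sub ((hs.pow 3).div_const 3)).const_mul (a11 * s1)).add
      ((((hc.pow 3).neg.div_const 3)).const_mul (a12 * s2 + (a21 + b11) * s1))).add
      (((hs.pow 3).div_const 3).const_mul ((a22 + b12) * s2 + b21 * s1)) |>.add
      ((hc.neg.add ((hc.pow 3).div_const 3)).const_mul (b22 * s2))
    refine this.congr_deriv ?_
    simp only [AA, qq, h1 x hx, h2 x hx]
    have hcs := Real.sin_sq_add_cos_sq x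
    generalize cos x = c at *
    generalize sin x = s at *
    have hc2 : c ^ 2 = 1 - s ^ 2 := by linarith
    push_cast
    linear_combination (-(a11 * s1 * c) - b22 * s2 * s) * hcs
  · exact (AA_cont (qq_cont _ _ _ _) (qq_cont _ _ _ _)).intervalIntegrable _ _

lemma AA_integral : ∫ x in (0:ℝ)..(2 * π), AA (qq a11 a12 a21 a22) (qq b11 b12 b21 b22) x =
      4 * (2 * a11 + a12 + b21 + 2 * b22) / 3 := by
  have hp := Real.pi_pos
  have hInteg : ∀ p q, IntervalIntegrable (AA (qq a11 a12 a21 a22) (qq b11 b12 b21 b22)) MeasureTheory.volume p q :=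
    fun p q => (AA_cont (qq_cont _ _ _ _) (qq_cont _ _ _ _)).intervalIntegrable _ _
  have hA := AA_cont (qq_cont a11 a12 a21 a22) (qq_cont b11 b12 b21 b22)
  have q1 := quarter a11 a12 a21 a22 b11 b12 b21 b22 1 1 0 (π / 2) (by linarith)
    (fun x hx => by
      rw [one_mul, abs_of_nonneg (cos_nonneg_of_mem_Icc ⟨by linarith [hx.1], hx.2⟩)])
    (fun x hx => by
      rw [one_mul, abs_of_nonneg (sin_nonneg_of_nonneg_of_le_pi hx.1 (by linarith [hx.2]))])
  have q2 := quarter a11 a12 a21 a22 b11 b12 b21 b22 (-1) 1 (π / 2) π (by linarith)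
    (fun x hx => by
      rw [abs_of_nonpos (cos_nonpos_of_pi_div_two_le_of_le hx.1 (by linarith [hx.2]))]; ring)
    (fun x hx => by
      rw [one_mul, abs_of_nonneg (sin_nonneg_of_nonneg_of_le_pi (by linarith [hx.1]) hx.2)])
  have hsn : ∀ x, π ≤ x → x ≤ 2 * π → sin x ≤ 0 := fun x h1 h2 => by
    have := sin_nonneg_of_nonneg_of_le_pi (x := x - π) (by linarith) (by linarith)
    rw [sin_sub_pi] at this; linarith
  have q3 := quarter a11 a12 a21 a22 b11 b12 b21 b22 (-1) (-1) π (π / 2 + π) (by linarith)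
    (fun x hx => by
      rw [abs_of_nonpos (cos_nonpos_of_pi_div_two_le_of_le (by linarith [hx.1]) (by linarith [hx.2]))]; ring)
    (fun x hx => by
      rw [abs_of_nonpos (hsn x hx.1 (by linarith [hx.2]))]; ring)
  have q4 := quarter a11 a12 a21 a22 b11 b12 b21 b22 1 (-1) (π / 2 + π) (2 * π) (by linarith)
    (fun x hx => by
      have : 0 ≤ cos (x - 2 * π) :=
        cos_nonneg_of_mem_Icc ⟨by linarith [hx.1], by linarith [hx.2]⟩
      rw [cos_sub_two_pi] at this
      rw [one_mul, abs_of_nonneg this])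
    (fun x hx => by
      rw [abs_of_nonpos (hsn x (by linarith [hx.1]) hx.2)]; ring)
  rw [← intervalIntegral.integral_add_adjacent_intervals (hInteg 0 (π/2)) (hInteg (π/2) (2 * π)),
    ← intervalIntegral.integral_add_adjacent_intervals (hInteg (π/2) π) (hInteg π (2 * π)),
    ← intervalIntegral.integral_add_adjacent_intervals (hInteg π (π/2 + π)) (hInteg (π/2+π) (2 * π)),
    q1, q2, q3, q4]
  simp only [GG, sin_add_pi, cos_add_pi, sin_pi_div_two, cos_pi_div_two, sin_pi, cos_pi, sin_zero,
    cos_zero, sin_two_pi, cos_two_pi]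
  ring
end

lemma periodic_int {h : ℝ → ℝ} (hp : ∀ x, h (x + 2 * π) = h x) (k : ℤ) (x : ℝ) :
    h (x + k * (2 * π)) = h x := Function.Periodic.int_mul (f := h) hp k x

lemma periodic_bdd {h : ℝ → ℝ} (hc : Continuous h) {T : ℝ} (hT : 0 < T) (hp : ∀ x, h (x + T) = h x) :
    ∃ C, ∀ x, |h x| ≤ C := by
  obtain ⟨C, hC⟩ := (isCompact_Icc (a := 0) (b := T)).bddAbove_image hc.abs.continuousOn
  refine ⟨C, fun x => ?_⟩
  obtain ⟨y, hy, hxy⟩ := Function.Periodic.exists_mem_Ico₀ (f := h) hp hT x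
  rw [hxy]
  exact hC ⟨y, ⟨hy.1, hy.2.le⟩, rfl⟩

lemma exists_psi {A : ℝ → ℝ} (hA : Continuous A) (hp : ∀ x, A (x + 2 * π) = A x) (Ab : ℝ)
    (hi : ∫ x in (0:ℝ)..(2 * π), A x = 2 * π * Ab) :
    ∃ (ψ : ℝ → ℝ) (Ψ : ℝ), (∀ x, ψ (x + 2 * π) = ψ x) ∧ (∀ x, HasDerivAt ψ (A x - Ab) x) ∧
      ∀ x, |ψ x| ≤ Ψ := by
  let ψ : ℝ → ℝ := fun x => ∫ s in (0:ℝ)..x, (A s - Ab)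
  have hc : Continuous (fun s => A s - Ab) := hA.sub continuous_const
  have hψ : ∀ x, HasDerivAt ψ (A x - Ab) x := fun x => (hc.integral_hasStrictDerivAt 0 x).hasDerivAt
  have hper : ∀ x, ψ (x + 2 * π) = ψ x := fun x => by
    have hd : ∀ x, HasDerivAt (fun x => ψ (x + 2 * π) - ψ x) 0 x := fun x => by
      refine (((hψ (x + 2 * π)).comp_add_const x (2 * π)).sub (hψ x)).congr_deriv ?_
      rw [hp]; ring
    have h1 := is_const_of_deriv_eq_zero (fun t => (hd t).differentiableAt) (fun t => (hd t).deriv) x 0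
    have h0 : ψ (0 + 2 * π) - ψ 0 = 0 := by
      simp only [ψ, zero_add, intervalIntegral.integral_same, sub_zero]
      rw [intervalIntegral.integral_sub (hA.intervalIntegrable _ _) (continuous_const.intervalIntegrable _ _), hi]
      simp
    rw [h0] at h1
    linarith
  have hψc : Continuous ψ := continuous_iff_continuousAt.2 fun x => (hψ x).continuousAt
  obtain ⟨C, hC⟩ := periodic_bdd hψc Real.two_pi_pos hper
  exact ⟨ψ, C, hper, hψ, hC⟩


noncomputable def mm (ω : ℝ) (A B : ℝ → ℝ) (μ : ℝ) (ρ : ℝ → ℝ) (x : ℝ) : ℝ :=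
  (μ + A x / ρ x) * B x / (ω + B x / ρ x)

/-- data for the invariant curve -/
structure RS (ω S : ℝ) (A B : ℝ → ℝ) (μ δ ρm ρM : ℝ) (ρ : ℝ → ℝ) : Prop where
  hω : ω ≠ 0
  hS : 0 < S
  hδ : 0 < δ
  hA : ∀ x, |A x| ≤ S
  hB : ∀ x, |B x| ≤ S
  hAc : Continuous A
  hBc : Continuous B
  hAp : ∀ x, A (x + 2 * π) = A x
  hBp : ∀ x, B (x + 2 * π) = B x
  hμ : μ ≠ 0
  hm0 : 0 < ρm
  hmδ : 1 < δ * ρm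
  hlo : ∀ x, ρm ≤ ρ x
  hhi : ∀ x, ρ x ≤ ρM
  hd : ∀ x, HasDerivAt ρ (-(μ * ρ x + A x) / (ω + B x / ρ x)) x
  hp : ∀ x, ρ (x + 2 * π) = ρ x
  hBρ : ∀ x, |B x / ρ x| ≤ |ω| / 2
  hmm : ∀ x, δ * |mm ω A B μ ρ x| ≤ |μ| / 2

namespace RS
variable {ω S : ℝ} {A B : ℝ → ℝ} {μ δ ρm ρM : ℝ} {ρ : ℝ → ℝ}

lemma pos (H : RS ω S A B μ δ ρm ρM ρ) (x : ℝ) : 0 < ρ x := H.hm0.trans_le (H.hlo x)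

lemma cont (H : RS ω S A B μ δ ρm ρM ρ) : Continuous ρ :=
  continuous_iff_continuousAt.2 fun x => (H.hd x).continuousAt

lemma den_abs {ω b : ℝ} (h : |b| ≤ |ω| / 2) : |ω| / 2 ≤ |ω + b| := by
  have := abs_sub_abs_le_abs_sub ω (-b)
  rw [abs_neg, sub_neg_eq_add] at this
  linarith

lemma den (H : RS ω S A B μ δ ρm ρM ρ) (x : ℝ) : ω + B x / ρ x ≠ 0 := by
  have := den_abs (H.hBρ x)
  have h := abs_pos.2 H.hω
  exact abs_pos.1 (by linarith)

/-- The key algebraic identity. -/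
lemma key (H : RS ω S A B μ δ ρm ρM ρ) (x r : ℝ) (hr : 0 < r) :
    -(μ * r + r ^ 2 * A x) / r ^ 2 - (-(μ * ρ x + A x) / (ω + B x / ρ x)) * (ω + r * B x)
      = - (1 / r - ρ x) * (μ + r * mm ω A B μ ρ x) := by
  have h1 := (H.pos x).ne'
  have h2 := H.den x
  have h3 : ω * ρ x + B x ≠ 0 := by
    intro h; apply h2; field_simp; linarith
  have e : ω + B x / ρ x = (ω * ρ x + B x) / ρ x := by field_simp
  unfold mm
  rw [e]
  generalize ρ x = q at *
  generalize A x = a at *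
  obtain ⟨E, hE⟩ : ∃ E, E = ω * q + B x := ⟨_, rfl⟩
  have hb : B x = E - ω * q := by rw [hE]; ring
  rw [← hE, hb]
  rw [← hE] at h3
  have hr0 := hr.ne'
  field_simp
  ring

lemma Dderiv (H : RS ω S A B μ δ ρm ρM ρ) {r x : ℝ → ℝ} (hr : ∀ t, 0 < r t)
    (hr' : ∀ t, HasDerivAt r (μ * r t + r t ^ 2 * A (x t)) t)
    (hx' : ∀ t, HasDerivAt x (ω + r t * B (x t)) t) (t : ℝ) :
    HasDerivAt (fun t => 1 / r t - ρ (x t))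
      (- (1 / r t - ρ (x t)) * (μ + r t * mm ω A B μ ρ (x t))) t := by
  have h1 := ((hr' t).inv (hr t).ne').sub ((H.hd (x t)).comp t (hx' t))
  have e : (fun t => 1 / r t - ρ (x t)) = r⁻¹ - ρ ∘ x := by
    ext t; simp
  rw [e]
  exact h1.congr_deriv (H.key (x t) (r t) (hr t))

lemma kb (H : RS ω S A B μ δ ρm ρM ρ) (x r : ℝ) (hr : 0 < r) (hrd : r ≤ δ) :
    |r * mm ω A B μ ρ x| ≤ |μ| / 2 := by
  rw [abs_mul, abs_of_pos hr]
  exact (mul_le_mul_of_nonneg_right hrd (abs_nonneg _)).trans (H.hmm x)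

/-- uniqueness: small periodic in polar form is on the curve -/
lemma D_zero (H : RS ω S A B μ δ ρm ρM ρ) {r x : ℝ → ℝ} (hr : ∀ t, 0 < r t) (hrd : ∀ t, r t ≤ δ)
    (hr' : ∀ t, HasDerivAt r (μ * r t + r t ^ 2 * A (x t)) t)
    (hx' : ∀ t, HasDerivAt x (ω + r t * B (x t)) t) (T : ℝ) (hT : 0 < T)
    (hper : ∀ t, 1 / r (t + T) - ρ (x (t + T)) = 1 / r t - ρ (x t)) (t : ℝ) :
    1 / r t = ρ (x t) := by
  set D : ℝ → ℝ := fun t => 1 / r t - ρ (x t) with hD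
  set k : ℝ → ℝ := fun t => μ + r t * mm ω A B μ ρ (x t) with hk
  have hD' : ∀ t, HasDerivAt D (- D t * k t) t := H.Dderiv hr hr' hx'
  have hV : ∀ t, HasDerivAt (fun t => μ * D t ^ 2) (-2 * (μ * k t) * D t ^ 2) t := fun t => by
    refine (((hD' t).pow 2).const_mul μ).congr_deriv ?_
    push_cast; ring
  have hk0 : ∀ t, 0 < μ * k t := fun t => by
    have h := abs_le.1 (H.kb (x t) (r t) (hr t) (hrd t))
    simp only [hk]
    rcases lt_or_gt_of_ne H.hμ with h0 | h0
    · rw [abs_of_neg h0] at h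
      nlinarith
    · rw [abs_of_pos h0] at h
      nlinarith
  have hanti : Antitone (fun t => μ * D t ^ 2) := by
    apply antitone_of_deriv_nonpos (fun t => (hV t).differentiableAt)
    intro t
    rw [(hV t).deriv]
    have := mul_nonneg (hk0 t).le (sq_nonneg (D t))
    linarith
  have hconst : ∀ s ∈ Ioo t (t + T), μ * D s ^ 2 = μ * D t ^ 2 := fun s hs => by
    have h1 := hanti hs.1.le
    have h2 := hanti hs.2.le
    have h3 : D (t + T) = D t := hper t
    simp only [h3] at h1 h2
    linarith
  have hs : t + T / 2 ∈ Ioo t (t + T) := ⟨by linarith, by linarith⟩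
  have hz : HasDerivAt (fun t => μ * D t ^ 2) 0 (t + T / 2) := by
    refine (hasDerivAt_const (t + T / 2) (μ * D t ^ 2)).congr_of_eventuallyEq ?_
    filter_upwards [Ioo_mem_nhds hs.1 hs.2] with s hs'
    exact hconst s hs'
  have h0 := (hV (t + T / 2)).unique hz
  have h1 : D (t + T / 2) ^ 2 = 0 := by
    rcases mul_eq_zero.1 h0 with h | h
    · have := hk0 (t + T / 2); linarith
    · exact h
  have h2 := hconst _ hs
  rw [h1] at h2
  have h3 : D t ^ 2 = 0 := by
    rcases mul_eq_zero.1 (show μ * D t ^ 2 = 0 by linarith) with h | h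
    · exact absurd h H.hμ
    · exact h
  have h4 : D t = 0 := pow_eq_zero_iff (two_ne_zero) |>.1 h3
  simp only [hD] at h4
  linarith

lemma tc (H : RS ω S A B μ δ ρm ρM ρ) : Continuous (fun x => ω + B x / ρ x) :=
  continuous_const.add (H.hBc.div H.cont fun x => (H.pos x).ne')

/-- the point on the curve -/
noncomputable def P (ρ : ℝ → ℝ) (x : ℝ) : ℝ × ℝ := (1 / ρ x * cos x, 1 / ρ x * sin x)

lemma decay (H : RS ω S A B μ δ ρm ρM ρ) (hμ : 0 < μ) {r x : ℝ → ℝ} (hr : ∀ t, 0 < r t)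
    (hr' : ∀ t, HasDerivAt r (μ * r t + r t ^ 2 * A (x t)) t)
    (hx' : ∀ t, HasDerivAt x (ω + r t * B (x t)) t) (c : ℝ) (hc : 0 < c) (hcδ : c ≤ ρm - 1 / δ)
    (h0 : |1 / r 0 - ρ (x 0)| ≤ c) :
    ∀ t ≥ 0, r t ≤ δ ∧ (1 / r t - ρ (x t)) ^ 2 ≤ c ^ 2 * exp (-(μ * t)) := by
  set D : ℝ → ℝ := fun t => 1 / r t - ρ (x t) with hD
  set k : ℝ → ℝ := fun t => μ + r t * mm ω A B μ ρ (x t) with hk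
  have hδ := H.hδ
  have hD' : ∀ t, HasDerivAt D (- D t * k t) t := H.Dderiv hr hr' hx'
  have hV : ∀ t, HasDerivAt (fun t => D t ^ 2) (-2 * k t * D t ^ 2) t := fun t => by
    refine ((hD' t).pow 2).congr_deriv ?_
    push_cast; ring
  have hrle : ∀ t, D t ^ 2 ≤ c ^ 2 → r t ≤ δ := fun t h => by
    have h1 := (abs_le.1 (abs_le_of_sq_le_sq h hc.le)).1
    have h2 := H.hlo (x t)
    have h3 : 1 / δ ≤ 1 / r t := by simp only [hD] at h1; linarith
    exact (one_div_le_one_div hδ (hr t)).1 h3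
  have hkle : ∀ t, D t ^ 2 ≤ c ^ 2 → μ / 2 ≤ k t := fun t h => by
    have h := abs_le.1 (H.kb (x t) (r t) (hr t) (hrle t h))
    rw [abs_of_pos hμ] at h
    simp only [hk]; linarith
  have hbar : ∀ t ≥ 0, D t ^ 2 ≤ c ^ 2 := by
    refine barrier_le _ _ (c ^ 2) hV (fun t ht => ?_) 0 (sq_le_sq' (by linarith [(abs_le.1 h0).1]) (abs_le.1 h0).2)
    have := hkle t ht.le
    rw [ht]
    have : 0 < k t := by linarith
    have := mul_pos this (pow_pos hc 2)
    linarith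
  have hW : ∀ t, HasDerivAt (fun t => D t ^ 2 * exp (μ * t)) ((μ - 2 * k t) * D t ^ 2 * exp (μ * t)) t := fun t => by
    have he : HasDerivAt (fun t => exp (μ * t)) (exp (μ * t) * (μ * 1)) t := ((hasDerivAt_id t).const_mul μ).exp
    refine ((hV t).mul he).congr_deriv ?_
    ring
  have hanti : AntitoneOn (fun t => D t ^ 2 * exp (μ * t)) (Ici 0) := by
    refine antitoneOn_of_deriv_nonpos (convex_Ici 0) (fun t _ => (hW t).continuousAt.continuousWithinAt)
      (fun t _ => (hW t).differentiableAt.differentiableWithinAt) (fun t ht => ?_)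
    rw [interior_Ici] at ht
    rw [(hW t).deriv]
    have h1 := hkle t (hbar t (le_of_lt ht))
    have h2 := mul_nonneg (sq_nonneg (D t)) (exp_pos (μ * t)).le
    nlinarith
  intro t ht
  refine ⟨hrle t (hbar t ht), ?_⟩
  have h1 := hanti (a := 0) (b := t) (by simp) ht ht
  simp only [mul_zero, exp_zero, mul_one] at h1
  have h2 := hbar 0 le_rfl
  rw [exp_neg, ← div_eq_mul_inv, le_div_iff₀ (exp_pos _)]
  exact h1.trans h2

lemma infDist_le (H : RS ω S A B μ δ ρm ρM ρ) (r x : ℝ) (hr : 0 < r) (hrd : r ≤ δ) :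
    infDist ((r * cos x, r * sin x) : ℝ × ℝ) (range (P ρ)) ≤ |1 / r - ρ x| * δ ^ 2 := by
  refine (infDist_le_dist_of_mem (mem_range_self x)).trans ?_
  have hρ := H.pos x
  have e : r - 1 / ρ x = - (1 / r - ρ x) * (r * (1 / ρ x)) := by field_simp; ring
  have h1 : |r - 1 / ρ x| ≤ |1 / r - ρ x| * δ ^ 2 := by
    rw [e, abs_mul, abs_neg]
    gcongr
    rw [abs_of_pos (by positivity), sq]
    gcongr
    · exact H.hδ.le
    · rw [div_le_iff₀ hρ]
      exact H.hmδ.le.trans (mul_le_mul_of_nonneg_left (H.hlo x) H.hδ.le)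
  rw [Prod.dist_eq, max_le_iff]
  simp only [P, Real.dist_eq, ← sub_mul, abs_mul]
  exact ⟨(mul_le_of_le_one_right (abs_nonneg _) (abs_cos_le_one x)).trans h1,
    (mul_le_of_le_one_right (abs_nonneg _) (abs_sin_le_one x)).trans h1⟩

end RS


namespace RS
variable {ω S : ℝ} {A B : ℝ → ℝ} {μ δ ρm ρM : ℝ} {ρ : ℝ → ℝ}

lemma hM (H : RS ω S A B μ δ ρm ρM ρ) : 0 < ρM := (H.pos 0).trans_le (H.hhi 0)

lemma lip (H : RS ω S A B μ δ ρm ρM ρ) :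
    ∃ L > 0, ∀ x y, |ρ x - ρ y| ≤ L * |x - y| := by
  have hω := abs_pos.2 H.hω
  have hM := H.hM
  have hS := H.hS
  refine ⟨(|μ| * ρM + S) / (|ω| / 2), by positivity, fun x y => ?_⟩
  have := convex_univ.norm_image_sub_le_of_norm_hasDerivWithin_le (f := ρ)
    (f' := fun x => (-(μ * ρ x + A x) / (ω + B x / ρ x))) (C := (|μ| * ρM + S) / (|ω| / 2))
    (fun x _ => (H.hd x).hasDerivWithinAt) (fun x _ => ?_) (mem_univ y) (mem_univ x)
  · exact this
  · rw [Real.norm_eq_abs, abs_div, abs_neg]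
    have h1 := den_abs (H.hBρ x)
    have h2 : |μ * ρ x + A x| ≤ |μ| * ρM + S := by
      refine (abs_add_le _ _).trans (add_le_add ?_ (H.hA x))
      rw [abs_mul, abs_of_pos (H.pos x)]
      exact mul_le_mul_of_nonneg_left (H.hhi x) (abs_nonneg _)
    gcongr

set_option maxHeartbeats 1000000 in
lemma near (H : RS ω S A B μ δ ρm ρM ρ) (c : ℝ) (hc : 0 < c) :
    ∃ ζ > 0, ∀ p : ℝ × ℝ, infDist p (range (P ρ)) < ζ →
      ∃ r0 x0, 0 < r0 ∧ p = (r0 * cos x0, r0 * sin x0) ∧ |1 / r0 - ρ x0| ≤ c := by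
  obtain ⟨L, hL, hlip⟩ := H.lip
  have hM := H.hM
  have hpi := Real.pi_pos
  set Q := 4 * ρM ^ 2 + L * π * ρM with hQ
  have hQ0 : 0 < Q := by positivity
  refine ⟨min (1 / ρM / 4) (c / Q), by positivity, fun p hp => ?_⟩
  set ζ := min (1 / ρM / 4) (c / Q) with hζ
  have hζ0 : 0 < ζ := by positivity
  have hζ1 : ζ ≤ 1 / ρM / 4 := min_le_left _ _
  have hζ2 : ζ ≤ c / Q := min_le_right _ _
  obtain ⟨q, ⟨y, rfl⟩, hq⟩ := (infDist_lt_iff (range_nonempty _)).1 hp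
  set s := 1 / ρ y with hs
  have hρy := H.pos y
  have hs0 : 0 < s := by positivity
  have hsm : 1 / ρM ≤ s := one_div_le_one_div_of_le hρy (H.hhi y)
  have hsM : 1 / s ≤ ρM := by rw [hs, one_div_one_div]; exact H.hhi y
  rw [Prod.dist_eq, max_lt_iff] at hq
  obtain ⟨q1, q2⟩ := hq
  simp only [P, Real.dist_eq, ← hs] at q1 q2
  have g1 : (p.1 - s * cos y) ^ 2 < ζ ^ 2 := sq_lt_sq' (abs_lt.1 q1).1 (abs_lt.1 q1).2
  have g2 : (p.2 - s * sin y) ^ 2 < ζ ^ 2 := sq_lt_sq' (abs_lt.1 q2).1 (abs_lt.1 q2).2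
  have hcs := Real.sin_sq_add_cos_sq y
  have hζs : ζ ≤ s / 4 := by linarith
  have hp0 : p ≠ 0 := by
    intro h0
    rw [h0] at g1 g2
    simp only [Prod.fst_zero, Prod.snd_zero] at g1 g2
    have : s ^ 2 < 2 * ζ ^ 2 := by nlinarith
    nlinarith
  obtain ⟨r0, x1, hr0, hpx⟩ := exists_polar p hp0
  obtain ⟨k, hk, -⟩ := existsUnique_add_zsmul_mem_Ioc Real.two_pi_pos x1 (y - π)
  simp only [zsmul_eq_mul] at hk
  set x0 := x1 + k * (2 * π) with hx0
  have hc0 : cos x0 = cos x1 := by rw [hx0]; exact Real.cos_add_int_mul_two_pi x1 k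
  have hs1 : sin x0 = sin x1 := by rw [hx0]; exact Real.sin_add_int_mul_two_pi x1 k
  rw [← hc0, ← hs1] at hpx
  have hcs0 := Real.sin_sq_add_cos_sq x0
  have hid : (r0 - s) ^ 2 + 2 * (r0 * s) * (1 - cos (x0 - y)) < 2 * ζ ^ 2 := by
    rw [hpx] at g1 g2
    simp only at g1 g2
    have : (r0 - s) ^ 2 + 2 * (r0 * s) * (1 - cos (x0 - y)) =
        (r0 * cos x0 - s * cos y) ^ 2 + (r0 * sin x0 - s * sin y) ^ 2 := by
      rw [cos_sub]
      linear_combination (-r0 ^ 2) * hcs0 - s ^ 2 * hcs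
    linarith
  have hrs : 0 < r0 * s := by positivity
  have hcos1 : 0 ≤ 1 - cos (x0 - y) := by linarith [cos_le_one (x0 - y)]
  have hd1 : |r0 - s| ≤ 2 * ζ := by
    apply abs_le_of_sq_le_sq _ (by positivity)
    nlinarith only [mul_nonneg hrs.le hcos1, hid, sq_nonneg ζ]
  have hr0s : s / 2 ≤ r0 := by linarith [(abs_le.1 hd1).1]
  have hxy : |x0 - y| ≤ π := abs_le.2 ⟨by linarith [hk.1], by linarith [hk.2]⟩
  have hq := Real.cos_le_one_sub_mul_cos_sq hxy
  have hd2 : |x0 - y| ≤ π * ζ / s := by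
    apply abs_le_of_sq_le_sq _ (by positivity)
    have h1 : 2 / π ^ 2 * (x0 - y) ^ 2 ≤ 1 - cos (x0 - y) := by linarith
    have h2 : s ^ 2 * (2 / π ^ 2 * (x0 - y) ^ 2) ≤ 2 * ζ ^ 2 := by
      calc s ^ 2 * (2 / π ^ 2 * (x0 - y) ^ 2) ≤ (2 * (r0 * s)) * (2 / π ^ 2 * (x0 - y) ^ 2) := by
            have h7 : s ^ 2 ≤ 2 * (r0 * s) := by rw [sq]; nlinarith only [hr0s, hs0]
            exact mul_le_mul_of_nonneg_right h7 (by positivity)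
        _ ≤ (2 * (r0 * s)) * (1 - cos (x0 - y)) := mul_le_mul_of_nonneg_left h1 (by positivity)
        _ ≤ 2 * ζ ^ 2 := by linarith only [sq_nonneg (r0 - s), hid]
    rw [div_pow, mul_pow, le_div_iff₀ (by positivity)]
    have e : s ^ 2 * (2 / π ^ 2 * (x0 - y) ^ 2) = 2 * ((x0 - y) ^ 2 * s ^ 2) / π ^ 2 := by field_simp
    rw [e, div_le_iff₀ (by positivity)] at h2
    linarith
  refine ⟨r0, x0, hr0, hpx, ?_⟩
  have hy : ρ y = 1 / s := by rw [hs, one_div_one_div]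
  have t1 : |1 / r0 - ρ y| ≤ 4 * ζ * ρM ^ 2 := by
    have e : 1 / r0 - ρ y = -(r0 - s) * ((1 / r0) * (1 / s)) := by rw [hy]; field_simp; ring
    have h1 : 1 / r0 ≤ 2 * ρM := by
      calc 1 / r0 ≤ 1 / (s / 2) := one_div_le_one_div_of_le (by positivity) hr0s
        _ = 2 * (1 / s) := by field_simp
        _ ≤ 2 * ρM := by linarith
    rw [e, abs_mul, abs_neg, abs_of_pos (show 0 < (1 / r0) * (1 / s) by positivity)]
    calc |r0 - s| * (1 / r0 * (1 / s)) ≤ (2 * ζ) * ((2 * ρM) * ρM) := by gcongr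
      _ = _ := by ring
  have t2 : |ρ y - ρ x0| ≤ L * (π * ζ * ρM) := by
    refine (hlip y x0).trans ?_
    rw [abs_sub_comm]
    gcongr
    refine hd2.trans ?_
    rw [div_eq_mul_one_div]
    gcongr
  have t3 : |1 / r0 - ρ x0| ≤ |1 / r0 - ρ y| + |ρ y - ρ x0| := abs_sub_le _ _ _
  have : ζ * Q ≤ c := (le_div_iff₀ hQ0).1 hζ2
  rw [hQ] at this
  linarith

lemma stable {f g : ℝ → ℝ → ℝ} (H : RS ω S (AA f g) (BB f g) μ δ ρm ρM ρ) (hμ : 0 < μ)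
    (hf : ∀ r v w, 0 ≤ r → f (r * v) (r * w) = r ^ 2 * f v w)
    (hg : ∀ r v w, 0 ≤ r → g (r * v) (r * w) = r ^ 2 * g v w)
    (hfc : Continuous (Function.uncurry f)) (hgc : Continuous (Function.uncurry g))
    (hfS : ∀ v w, |f v w| ≤ S * (v ^ 2 + w ^ 2)) (hgS : ∀ v w, |g v w| ≤ S * (v ^ 2 + w ^ 2)) :
    OrbitallyAsympStable2 (PF ω f g μ) (range (P ρ)) := by
  have hδ := H.hδ
  have hc0 : 0 < ρm - 1 / δ := by
    have := H.hmδ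
    rw [sub_pos, div_lt_iff₀ hδ]; linarith
  have main : ∀ c, 0 < c → c ≤ ρm - 1 / δ → ∃ ζ > 0, ∀ u : ℝ → ℝ × ℝ, IsSolution2 (PF ω f g μ) u →
      infDist (u 0) (range (P ρ)) < ζ → ∀ t ≥ 0,
        infDist (u t) (range (P ρ)) ≤ c * exp (-(μ * t) / 2) * δ ^ 2 := by
    intro c hc hcc
    obtain ⟨ζ, hζ, hn⟩ := H.near c hc
    refine ⟨ζ, hζ, fun u hu h0 t ht => ?_⟩
    obtain ⟨r0, x0, hr0, hp, hD⟩ := hn (u 0) h0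
    have hu0 : u 0 ≠ 0 := by
      intro h
      rw [hp] at h
      have h1 : r0 * cos x0 = 0 := congrArg Prod.fst h
      have h2 : r0 * sin x0 = 0 := congrArg Prod.snd h
      have := Real.sin_sq_add_cos_sq x0
      have h3 : cos x0 = 0 := (mul_eq_zero.1 h1).resolve_left hr0.ne'
      have h4 : sin x0 = 0 := (mul_eq_zero.1 h2).resolve_left hr0.ne'
      rw [h3, h4] at this
      norm_num at this
    obtain ⟨r, x, e1, e2, hr, hux, hr', hx'⟩ := polar_lift hf hg hfc hgc hu
      (fun t ht => hu0 (sol_zero hfS hgS hu t ht 0)) r0 x0 hr0 hp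
    rw [← e1, ← e2] at hD
    obtain ⟨d1, d2⟩ := H.decay hμ hr hr' hx' c hc hcc hD t ht
    rw [hux t]
    refine (H.infDist_le (r t) (x t) (hr t) d1).trans ?_
    gcongr
    apply abs_le_of_sq_le_sq _ (by positivity)
    refine d2.trans (le_of_eq ?_)
    rw [mul_pow, ← exp_nat_mul]
    congr 2
    push_cast; ring
  constructor
  · intro η hη
    obtain ⟨ζ, hζ, h⟩ := main (min (ρm - 1 / δ) (η / (2 * δ ^ 2))) (by positivity) (min_le_left _ _)
    refine ⟨ζ, hζ, fun u hu h0 t ht => (h u hu h0 t ht).trans_lt ?_⟩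
    have h1 : exp (-(μ * t) / 2) ≤ 1 := by
      rw [exp_le_one_iff]
      have := mul_nonneg hμ.le ht
      linarith
    calc min (ρm - 1 / δ) (η / (2 * δ ^ 2)) * exp (-(μ * t) / 2) * δ ^ 2
        ≤ (η / (2 * δ ^ 2)) * 1 * δ ^ 2 := by
          gcongr
          exact min_le_right _ _
      _ = η / 2 := by field_simp
      _ < η := by linarith
  · obtain ⟨ζ, hζ, h⟩ := main (ρm - 1 / δ) hc0 le_rfl
    refine ⟨ζ, hζ, fun u hu h0 => ?_⟩
    refine squeeze_zero' (Eventually.of_forall fun t => infDist_nonneg)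
      (by filter_upwards [eventually_ge_atTop 0] with t ht using h u hu h0 t ht) ?_
    have : Tendsto (fun t => exp (-(μ * t) / 2)) atTop (nhds 0) := by
      refine tendsto_exp_atBot.comp ?_
      have := (tendsto_id (α := ℝ) (x := atTop)).const_mul_atTop_of_neg (show -μ / 2 < 0 by linarith)
      refine this.congr fun t => ?_
      simp only [id]; ring
    have := (this.const_mul (ρm - 1 / δ)).mul_const (δ ^ 2)
    simpa using this

end RS


namespace RS
variable {ω S : ℝ} {A B : ℝ → ℝ} {μ δ ρm ρM : ℝ} {ρ : ℝ → ℝ}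

lemma BRle (H : RS ω S A B μ δ ρm ρM ρ) (x s : ℝ) (hs : 0 < s) (hs1 : s ≤ 1 / ρ x) :
    |s * B x| ≤ |ω| / 2 := by
  refine le_trans ?_ (H.hBρ x)
  rw [abs_mul, abs_of_pos hs, abs_div, abs_of_pos (H.pos x), div_eq_mul_one_div, mul_comm]
  exact mul_le_mul_of_nonneg_left hs1 (abs_nonneg _)

lemma exp_lip {q : ℝ} (hq : 0 < q) (x y : ℝ) :
    |1 / (q + exp x) - 1 / (q + exp y)| ≤ 1 / q * |x - y| := by
  wlog hxy : x ≤ y generalizing x y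
  · rw [abs_sub_comm, abs_sub_comm x]
    exact this y x (le_of_not_ge hxy)
  have hx := exp_pos x
  have hy := exp_pos y
  have e : 1 / (q + exp x) - 1 / (q + exp y) = (exp y - exp x) / ((q + exp x) * (q + exp y)) := by
    field_simp; ring
  have h1 : exp y - exp x ≤ exp y * (y - x) := by
    have h := add_one_le_exp (x - y)
    have : exp x = exp y * exp (x - y) := by rw [← exp_add]; congr 1; ring
    rw [this]
    nlinarith
  have h2 : 0 ≤ exp y - exp x := by linarith [exp_le_exp.2 hxy]
  rw [e, abs_of_nonneg (by positivity), abs_of_nonpos (by linarith), div_le_iff₀ (by positivity)]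
  have h3 : 0 ≤ y - x := by linarith
  calc exp y - exp x ≤ exp y * (y - x) := h1
    _ ≤ (q + exp y) * (y - x) := by gcongr; linarith
    _ = 1 / q * -(x - y) * (q * (q + exp y)) := by field_simp; ring
    _ ≤ 1 / q * -(x - y) * ((q + exp x) * (q + exp y)) := by
        have : 0 ≤ -(x - y) := by linarith
        gcongr; linarith

lemma sR (H : RS ω S A B μ δ ρm ρM ρ) (t x : ℝ) :
    0 < 1 / (ρ t + exp x) ∧ 1 / (ρ t + exp x) ≤ 1 / ρ t ∧ 1 / (ρ t + exp x) ≤ δ := by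
  have h1 := H.pos t
  have h2 := exp_pos x
  have h3 : 1 / (ρ t + exp x) ≤ 1 / ρ t := one_div_le_one_div_of_le h1 (by linarith)
  refine ⟨by positivity, h3, h3.trans ?_⟩
  rw [div_le_iff₀ h1]
  exact H.hmδ.le.trans (mul_le_mul_of_nonneg_left (H.hlo t) H.hδ.le)

/-- the logarithmic equation for the deviation as a function of the angle -/
noncomputable def fld (ω : ℝ) (A B : ℝ → ℝ) (μ : ℝ) (ρ : ℝ → ℝ) (t x : ℝ) : ℝ :=
  -(μ + 1 / (ρ t + exp x) * mm ω A B μ ρ t) / (ω + 1 / (ρ t + exp x) * B t)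

lemma exists_x (H : RS ω S A B μ δ ρm ρM ρ) (x0 : ℝ) :
    ∃ x : ℝ → ℝ, x 0 = x0 ∧ ∀ t, HasDerivAt x (fld ω A B μ ρ t (x t)) t := by
  have hω := abs_pos.2 H.hω
  have hμ := abs_pos.2 H.hμ
  have hδ := H.hδ
  have hS := H.hS
  have hm0 := H.hm0
  have hden : ∀ t x, |ω| / 2 ≤ |ω + 1 / (ρ t + exp x) * B t| := fun t x =>
    den_abs (H.BRle t _ (H.sR t x).1 (H.sR t x).2.1)
  have hden0 : ∀ t x, ω + 1 / (ρ t + exp x) * B t ≠ 0 := fun t x => by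
    have := hden t x
    exact abs_pos.1 (by linarith)
  have hρc := H.cont
  have hmc : Continuous (mm ω A B μ ρ) := by
    unfold mm
    exact ((continuous_const.add (H.hAc.div hρc fun x => (H.pos x).ne')).mul H.hBc).div H.tc H.den
  have hne : ∀ t x, ρ t + exp x ≠ 0 := fun t x => by have := H.pos t; have := exp_pos x; positivity
  have hmb : ∀ t, |mm ω A B μ ρ t| ≤ |μ| / 2 / δ := fun t => by
    rw [le_div_iff₀ hδ, mul_comm]; exact H.hmm t
  let K : ℝ := (|ω| * (|μ| / 2 / δ) + |μ| * S) / (|ω| / 2 * (|ω| / 2)) * (1 / ρm)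
  let L : ℝ := (|μ| + |μ| / 2) / (|ω| / 2)
  have hK0 : 0 ≤ K := by positivity
  have hL0 : 0 ≤ L := by positivity
  refine global_exists (fld ω A B μ ρ) ⟨K, hK0⟩ ⟨L, hL0⟩ (fun x => ?_) (fun t => ?_) (fun t x => ?_) x0
  · unfold fld
    have h1 : Continuous (fun t => 1 / (ρ t + exp x)) :=
      continuous_const.div (hρc.add continuous_const) fun t => hne t x
    exact (continuous_const.add (h1.mul hmc)).neg.div (continuous_const.add (h1.mul H.hBc)) fun t => hden0 t x
  · refine LipschitzWith.of_dist_le_mul fun x y => ?_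
    rw [Real.dist_eq, Real.dist_eq]
    change _ ≤ K * _
    unfold fld
    have hl := exp_lip (H.pos t) x y
    have d1 := hden t x
    have d2 := hden t y
    have n1 := hden0 t x
    have n2 := hden0 t y
    generalize 1 / (ρ t + exp x) = s at *
    generalize 1 / (ρ t + exp y) = s' at *
    have e : -(μ + s * mm ω A B μ ρ t) / (ω + s * B t) - -(μ + s' * mm ω A B μ ρ t) / (ω + s' * B t)
        = -(s - s') * (ω * mm ω A B μ ρ t - μ * B t) / ((ω + s * B t) * (ω + s' * B t)) := by
      rw [div_sub_div _ _ n1 n2]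
      congr 1
      ring
    rw [e, abs_div, abs_mul, abs_neg, abs_mul]
    have h1 : |ω * mm ω A B μ ρ t - μ * B t| ≤ |ω| * (|μ| / 2 / δ) + |μ| * S := by
      refine (abs_sub _ _).trans ?_
      rw [abs_mul, abs_mul]
      have := hmb t
      have := H.hB t
      gcongr
    have h2 : |s - s'| ≤ 1 / ρm * |x - y| := by
      refine hl.trans ?_
      have := H.hlo t
      gcongr
    calc |s - s'| * |ω * mm ω A B μ ρ t - μ * B t| / (|ω + s * B t| * |ω + s' * B t|)
        ≤ (1 / ρm * |x - y|) * (|ω| * (|μ| / 2 / δ) + |μ| * S) / (|ω| / 2 * (|ω| / 2)) := by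
          gcongr
      _ = K * |x - y| := by simp only [K]; ring
  · change _ ≤ L
    unfold fld
    rw [abs_div, abs_neg]
    have h1 := H.kb t _ (H.sR t x).1 (H.sR t x).2.2
    have h2 : |μ + 1 / (ρ t + exp x) * mm ω A B μ ρ t| ≤ |μ| + |μ| / 2 :=
      (abs_add_le _ _).trans (by linarith)
    have := hden t x
    simp only [L]
    gcongr

lemma unstable {f g : ℝ → ℝ → ℝ} (H : RS ω S (AA f g) (BB f g) μ δ ρm ρM ρ) (hμ : μ < 0)
    (hf : ∀ r v w, 0 ≤ r → f (r * v) (r * w) = r ^ 2 * f v w)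
    (hg : ∀ r v w, 0 ≤ r → g (r * v) (r * w) = r ^ 2 * g v w) :
    ¬ OrbitallyStable2 (PF ω f g μ) (range (P ρ)) := by
  intro hst
  have hM := H.hM
  have hδ := H.hδ
  obtain ⟨ζ, hζ, hz⟩ := hst (1 / (4 * ρM)) (by positivity)
  obtain ⟨x, hx0, hx⟩ := H.exists_x (log (ζ / (2 * δ ^ 2)))
  have hxc : Continuous x := continuous_iff_continuousAt.2 fun t => (hx t).continuousAt
  let R : ℝ → ℝ := fun t => ρ t + exp (x t)
  have hR0 : ∀ t, 0 < R t := fun t => by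
    have := H.pos t; have := exp_pos (x t); positivity
  have hRc : Continuous R := H.cont.add hxc.rexp
  obtain ⟨φ, hφ, -, hφ0, -⟩ := angle_ode (fun t => ω + 1 / R t * BB f g t)
    (continuous_const.add ((continuous_const.div hRc fun t => (hR0 t).ne').mul H.hBc)) ω H.hω
    (fun t => by
      rw [add_sub_cancel_left]
      exact H.BRle t _ (H.sR t (x t)).1 (H.sR t (x t)).2.1)
  have hΘ : ∀ t, ω + 1 / R t * BB f g t ≠ 0 := fun t => by
    have h1 := den_abs (H.BRle t _ (H.sR t (x t)).1 (H.sR t (x t)).2.1)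
    have := abs_pos.2 H.hω
    exact abs_pos.1 (by linarith)
  -- derivative of R along φ
  have hR' : ∀ t, HasDerivAt (fun t => R (φ t)) (-(μ * R (φ t) + AA f g (φ t))) t := fun t => by
    have h1 : HasDerivAt R (-(μ * ρ (φ t) + AA f g (φ t)) / (ω + BB f g (φ t) / ρ (φ t))
      + exp (x (φ t)) * fld ω (AA f g) (BB f g) μ ρ (φ t) (x (φ t))) (φ t) := (H.hd _).add (hx _).exp
    refine (h1.comp t (hφ t)).congr_deriv ?_
    have hk := H.key (φ t) (1 / R (φ t)) (by have := hR0 (φ t); positivity)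
    have hn := hΘ (φ t)
    have e : exp (x (φ t)) * fld ω (AA f g) (BB f g) μ ρ (φ t) (x (φ t)) * (ω + 1 / R (φ t) * BB f g (φ t))
      = - exp (x (φ t)) * (μ + 1 / R (φ t) * mm ω (AA f g) (BB f g) μ ρ (φ t)) := by
      unfold fld
      change exp (x (φ t)) * (-(μ + 1 / R (φ t) * mm ω (AA f g) (BB f g) μ ρ (φ t)) / (ω + 1 / R (φ t) * BB f g (φ t)))
        * (ω + 1 / R (φ t) * BB f g (φ t)) = _
      rw [mul_assoc, div_mul_cancel₀ _ hn]; ring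
    rw [add_mul, e]
    have e2 : 1 / (1 / R (φ t)) - ρ (φ t) = exp (x (φ t)) := by
      rw [one_div_one_div]; simp only [R]; ring
    rw [e2] at hk
    have e3 : -(μ * (1 / R (φ t)) + (1 / R (φ t)) ^ 2 * AA f g (φ t)) / (1 / R (φ t)) ^ 2
      = -(μ * R (φ t) + AA f g (φ t)) := by
      have := (hR0 (φ t)).ne'
      field_simp
    rw [e3] at hk
    linarith
  have hsol : IsSolution2 (PF ω f g μ) (fun t => (1 / R (φ t) * cos (φ t), 1 / R (φ t) * sin (φ t))) := by
    refine polar_sol (fun t => 1 / R (φ t)) φ hf hg (fun t => by have := hR0 (φ t); positivity) (fun t => ?_) hφ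
    have e : (fun t => 1 / R (φ t)) = (fun t => R (φ t))⁻¹ := by ext t; simp
    have h1 := (hR' t).inv (hR0 (φ t)).ne'
    rw [← e] at h1
    refine h1.congr_deriv ?_
    have := (hR0 (φ t)).ne'
    field_simp
  have hgrow : ∀ t ≥ 0, x 0 + -μ / 2 * t ≤ x (φ t) := by
    have hd : ∀ t, HasDerivAt (fun t => x (φ t) - -μ / 2 * t)
        (-(μ + 1 / R (φ t) * mm ω (AA f g) (BB f g) μ ρ (φ t)) - -μ / 2) t := fun t => by
      have h1 := ((hx (φ t)).comp t (hφ t)).sub ((hasDerivAt_id t).const_mul (-μ / 2))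
      refine h1.congr_deriv ?_
      have hn := hΘ (φ t)
      unfold fld
      change -(μ + 1 / R (φ t) * mm ω (AA f g) (BB f g) μ ρ (φ t)) / (ω + 1 / R (φ t) * BB f g (φ t))
        * (ω + 1 / R (φ t) * BB f g (φ t)) - _ = _
      rw [div_mul_cancel₀ _ hn, mul_one]
    have hmono : Monotone (fun t => x (φ t) - -μ / 2 * t) := by
      apply monotone_of_deriv_nonneg (fun t => (hd t).differentiableAt)
      intro t
      rw [(hd t).deriv]
      have := abs_le.1 (H.kb (φ t) _ (H.sR (φ t) (x (φ t))).1 (H.sR (φ t) (x (φ t))).2.2)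
      rw [abs_of_neg hμ] at this
      have h2 := this.2
      change 1 / R (φ t) * _ ≤ _ at h2
      linarith
    intro t ht
    have := hmono ht
    simp only [hφ0, mul_zero, sub_zero] at this
    linarith
  have hstart : infDist ((1 / R (φ 0) * cos (φ 0), 1 / R (φ 0) * sin (φ 0)) : ℝ × ℝ) (range (P ρ)) < ζ := by
    refine (H.infDist_le _ _ (H.sR (φ 0) (x (φ 0))).1 (H.sR (φ 0) (x (φ 0))).2.2).trans_lt ?_
    have e2 : 1 / (1 / R (φ 0)) - ρ (φ 0) = exp (x (φ 0)) := by
      rw [one_div_one_div]; simp only [R]; ring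
    change |1 / (1 / R (φ 0)) - ρ (φ 0)| * δ ^ 2 < ζ
    rw [e2, hφ0, hx0, exp_log (by positivity), abs_of_pos (by positivity)]
    have : ζ / (2 * δ ^ 2) * δ ^ 2 = ζ / 2 := by field_simp
    linarith
  -- choose a late time
  let t : ℝ := max 0 ((4 * ρM - x 0) / (-μ / 2))
  have ht0 : 0 ≤ t := le_max_left _ _
  have ht1 : 4 * ρM - x 0 ≤ -μ / 2 * t := by
    have : (4 * ρM - x 0) / (-μ / 2) ≤ t := le_max_right _ _
    rw [div_le_iff₀ (by linarith)] at this
    linarith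
  have hbig : 4 * ρM ≤ R (φ t) := by
    have h1 := hgrow t ht0
    have h2 := add_one_le_exp (x (φ t))
    have h3 := H.pos (φ t)
    simp only [R]; linarith
  have hlate := hz _ hsol hstart t ht0
  obtain ⟨q, ⟨y, rfl⟩, hq⟩ := (infDist_lt_iff (range_nonempty _)).1 hlate
  rw [Prod.dist_eq, max_lt_iff] at hq
  obtain ⟨q1, q2⟩ := hq
  simp only [P, Real.dist_eq] at q1 q2
  have hs : 1 / ρM ≤ 1 / ρ y := one_div_le_one_div_of_le (H.pos y) (H.hhi y)
  have hr : 1 / R (φ t) ≤ 1 / (4 * ρM) := one_div_le_one_div_of_le (by positivity) hbig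
  have hr0 : 0 < 1 / R (φ t) := by have := hR0 (φ t); positivity
  have he : 1 / (4 * ρM) = 1 / ρM / 4 := by field_simp
  have hi : 0 < 1 / ρM := by positivity
  rw [he] at q1 q2 hr
  generalize 1 / R (φ t) = r at *
  generalize 1 / ρ y = s at *
  generalize 1 / ρM = m at *
  have c1 : |r * cos (φ t)| ≤ m / 4 := by
    rw [abs_mul, abs_of_pos hr0]
    exact (mul_le_of_le_one_right hr0.le (abs_cos_le_one _)).trans hr
  have c2 : |r * sin (φ t)| ≤ m / 4 := by
    rw [abs_mul, abs_of_pos hr0]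
    exact (mul_le_of_le_one_right hr0.le (abs_sin_le_one _)).trans hr
  have d1 : |s * cos y| < m / 2 := by
    have := abs_sub_abs_le_abs_sub (s * cos y) (r * cos (φ t))
    rw [abs_sub_comm] at this
    linarith
  have d2 : |s * sin y| < m / 2 := by
    have := abs_sub_abs_le_abs_sub (s * sin y) (r * sin (φ t))
    rw [abs_sub_comm] at this
    linarith
  have e1 : (s * cos y) ^ 2 < (m / 2) ^ 2 := sq_lt_sq' (abs_lt.1 d1).1 (abs_lt.1 d1).2
  have e2 : (s * sin y) ^ 2 < (m / 2) ^ 2 := sq_lt_sq' (abs_lt.1 d2).1 (abs_lt.1 d2).2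
  have hcs := Real.sin_sq_add_cos_sq y
  have e3 : s ^ 2 < m ^ 2 / 2 := by
    have : s ^ 2 = (s * cos y) ^ 2 + (s * sin y) ^ 2 := by linear_combination (-s ^ 2) * hcs
    linarith
  nlinarith

end RS


lemma polar_norm (r x : ℝ) (hr : 0 < r) : √((r * cos x) ^ 2 + (r * sin x) ^ 2) = r := by
  have : (r * cos x) ^ 2 + (r * sin x) ^ 2 = r ^ 2 := by
    linear_combination (r ^ 2) * Real.sin_sq_add_cos_sq x
  rw [this, sqrt_sq hr.le]

lemma per_polar {ω S μ δ : ℝ} {f g : ℝ → ℝ → ℝ} {u : ℝ → ℝ × ℝ}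
    (hf : ∀ r v w, 0 ≤ r → f (r * v) (r * w) = r ^ 2 * f v w)
    (hg : ∀ r v w, 0 ≤ r → g (r * v) (r * w) = r ^ 2 * g v w)
    (hfc : Continuous (Function.uncurry f)) (hgc : Continuous (Function.uncurry g))
    (hfS : ∀ v w, |f v w| ≤ S * (v ^ 2 + w ^ 2)) (hgS : ∀ v w, |g v w| ≤ S * (v ^ 2 + w ^ 2))
    (hu : IsPeriodicSolution2 (PF ω f g μ) u) (ha : ampl2 u < δ) :
    ∃ (r x : ℝ → ℝ) (T : ℝ), 0 < T ∧ (∀ t, 0 < r t) ∧ (∀ t, r t < δ) ∧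
      (∀ t, u t = (r t * cos (x t), r t * sin (x t))) ∧
      (∀ t, HasDerivAt r (μ * r t + r t ^ 2 * AA f g (x t)) t) ∧
      (∀ t, HasDerivAt x (ω + r t * BB f g (x t)) t) ∧
      (∀ t, r (t + T) = r t) ∧ (∀ t, ∃ k : ℤ, x (t + T) = x t + k * (2 * π)) := by
  obtain ⟨hs, ⟨T, hT, hper⟩, hnc⟩ := hu
  have hne : ∀ t, u t ≠ 0 := fun t ht => hnc fun s => by
    rw [sol_zero hfS hgS hs t ht s, sol_zero hfS hgS hs t ht 0]
  have huc : Continuous u := continuous_iff_continuousAt.2 fun t => (hs t).continuousAt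
  obtain ⟨r0, x0, hr0, hp⟩ := exists_polar (u 0) (hne 0)
  obtain ⟨r, x, -, -, hr, hux, hr', hx'⟩ := polar_lift hf hg hfc hgc hs hne r0 x0 hr0 hp
  have hper2 : ∀ t, r (t + T) = r t ∧ ∃ k : ℤ, x (t + T) = x t + k * (2 * π) := fun t => by
    refine polar_unique (hr _) (hr _) ?_
    rw [← hux, ← hux, hper]
  refine ⟨r, x, T, hT, hr, fun t => lt_of_le_of_lt ?_ ha, hux, hr', hx', fun t => (hper2 t).1, fun t => (hper2 t).2⟩
  have hn : ∀ t, √((u t).1 ^ 2 + (u t).2 ^ 2) = r t := fun t => by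
    rw [hux t]; exact polar_norm _ _ (hr t)
  have hb : BddAbove (range fun t => √((u t).1 ^ 2 + (u t).2 ^ 2)) := by
    obtain ⟨C, hC⟩ := periodic_bdd (h := r) (continuous_iff_continuousAt.2 fun t => (hr' t).continuousAt) hT
      fun t => (hper2 t).1
    refine ⟨C, ?_⟩
    rintro _ ⟨t, rfl⟩
    simp only [hn]
    exact (le_abs_self _).trans (hC t)
  have := le_ciSup hb t
  simp only [hn] at this
  unfold ampl2
  simp only [hn]
  exact this

lemma nonexist {ω S μ δ Ab : ℝ} {f g : ℝ → ℝ → ℝ} {u : ℝ → ℝ × ℝ} {ψ : ℝ → ℝ}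
    (hω : ω ≠ 0) (hS : 0 < S)
    (hf : ∀ r v w, 0 ≤ r → f (r * v) (r * w) = r ^ 2 * f v w)
    (hg : ∀ r v w, 0 ≤ r → g (r * v) (r * w) = r ^ 2 * g v w)
    (hfc : Continuous (Function.uncurry f)) (hgc : Continuous (Function.uncurry g))
    (hfS : ∀ v w, |f v w| ≤ S * (v ^ 2 + w ^ 2)) (hgS : ∀ v w, |g v w| ≤ S * (v ^ 2 + w ^ 2))
    (hA : ∀ x, |AA f g x| ≤ S) (hB : ∀ x, |BB f g x| ≤ S) (hAbS : |Ab| ≤ S) (hAb : Ab ≠ 0)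
    (hψp : ∀ x, ψ (x + 2 * π) = ψ x) (hψ : ∀ x, HasDerivAt ψ (AA f g x - Ab) x)
    (hδ : δ ≤ |Ab| * |ω| / (4 * S ^ 2)) (hμ : 0 < μ * Ab)
    (hu : IsPeriodicSolution2 (PF ω f g μ) u) (ha : ampl2 u < δ) : False := by
  obtain ⟨r, x, T, hT, hr, hrd, hux, hr', hx', hrp, hxp⟩ := per_polar hf hg hfc hgc hfS hgS hu ha
  have hω' := abs_pos.2 hω
  have hAb' := abs_pos.2 hAb
  have hd : ∀ t, HasDerivAt (fun t => Ab * ((r t)⁻¹ + ψ (x t) / ω))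
      (-(μ * Ab) / r t - Ab ^ 2 + Ab * (r t * (BB f g (x t) * (AA f g (x t) - Ab)) / ω)) t := fun t => by
    have h1 := ((hr' t).inv (hr t).ne').add (((hψ (x t)).comp t (hx' t)).div_const ω)
    refine (h1.const_mul Ab).congr_deriv ?_
    have := (hr t).ne'
    field_simp
    ring
  have hanti : StrictAnti (fun t => Ab * ((r t)⁻¹ + ψ (x t) / ω)) := by
    apply strictAnti_of_deriv_neg
    intro t
    rw [(hd t).deriv]
    have h1 : 0 < (μ * Ab) / r t := div_pos hμ (hr t)
    have h2 : |r t * (BB f g (x t) * (AA f g (x t) - Ab)) / ω| ≤ |Ab| / 2 := by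
      rw [abs_div, div_le_iff₀ hω', abs_mul, abs_mul, abs_of_pos (hr t)]
      have h3 : |AA f g (x t) - Ab| ≤ 2 * S := (abs_sub _ _).trans (by linarith [hA (x t)])
      have h4 := (hrd t).le.trans hδ
      calc r t * (|BB f g (x t)| * |AA f g (x t) - Ab|) ≤ (|Ab| * |ω| / (4 * S ^ 2)) * (S * (2 * S)) := by
            have := hB (x t)
            gcongr
        _ = |Ab| / 2 * |ω| := by field_simp; norm_num
    have h5 : Ab * (r t * (BB f g (x t) * (AA f g (x t) - Ab)) / ω) ≤ |Ab| * (|Ab| / 2) := by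
      refine (le_abs_self _).trans ?_
      rw [abs_mul]
      exact mul_le_mul_of_nonneg_left h2 hAb'.le
    have h6 : |Ab| * |Ab| = Ab ^ 2 := by rw [← sq, sq_abs]
    have h7 : 0 < Ab ^ 2 := by positivity
    have h8 : -(μ * Ab) / r t = -((μ * Ab) / r t) := neg_div _ _
    rw [h8]
    nlinarith
  have h1 := hanti (show (0:ℝ) < 0 + T by linarith)
  obtain ⟨k, hk⟩ := hxp 0
  have h2 : ψ (x (0 + T)) = ψ (x 0) := by rw [hk]; exact periodic_int hψp k _
  simp only [h2, hrp] at h1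
  exact lt_irrefl _ h1

namespace RS
variable {ω S : ℝ} {μ δ ρm ρM : ℝ} {ρ : ℝ → ℝ} {f g : ℝ → ℝ → ℝ}

lemma uniq (H : RS ω S (AA f g) (BB f g) μ δ ρm ρM ρ)
    (hf : ∀ r v w, 0 ≤ r → f (r * v) (r * w) = r ^ 2 * f v w)
    (hg : ∀ r v w, 0 ≤ r → g (r * v) (r * w) = r ^ 2 * g v w)
    (hfc : Continuous (Function.uncurry f)) (hgc : Continuous (Function.uncurry g))
    (hfS : ∀ v w, |f v w| ≤ S * (v ^ 2 + w ^ 2)) (hgS : ∀ v w, |g v w| ≤ S * (v ^ 2 + w ^ 2))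
    {u₁ u₂ : ℝ → ℝ × ℝ} (h1 : IsPeriodicSolution2 (PF ω f g μ) u₁)
    (h2 : IsPeriodicSolution2 (PF ω f g μ) u₂) (ha1 : ampl2 u₁ < δ) (ha2 : ampl2 u₂ < δ) :
    ∃ s : ℝ, ∀ t, u₂ t = u₁ (t + s) := by
  obtain ⟨φ, hφ, hsurj, hφ0, huq⟩ := angle_ode (fun x => ω + BB f g x / ρ x) H.tc ω H.hω (fun x => by
    rw [add_sub_cancel_left]; exact H.hBρ x)
  have main : ∀ u, IsPeriodicSolution2 (PF ω f g μ) u → ampl2 u < δ →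
      ∃ c, ∀ t, u t = P ρ (φ (t + c)) := by
    intro u hu ha
    obtain ⟨r, x, T, hT, hr, hrd, hux, hr', hx', hrp, hxp⟩ := per_polar hf hg hfc hgc hfS hgS hu ha
    have hD : ∀ t, 1 / r t = ρ (x t) := H.D_zero hr (fun t => (hrd t).le) hr' hx' T hT (fun t => by
      obtain ⟨k, hk⟩ := hxp t
      rw [hrp, hk, periodic_int H.hp])
    have hrr : ∀ t, r t = 1 / ρ (x t) := fun t => by rw [← hD, one_div_one_div]
    obtain ⟨c, hc⟩ := huq x (fun t => by
      refine (hx' t).congr_deriv ?_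
      rw [hrr t]; ring)
    refine ⟨c, fun t => ?_⟩
    rw [hux t, hrr t, ← hc]; rfl
  obtain ⟨c1, e1⟩ := main u₁ h1 ha1
  obtain ⟨c2, e2⟩ := main u₂ h2 ha2
  refine ⟨c2 - c1, fun t => ?_⟩
  rw [e1, e2]
  congr 2; ring

lemma exis (H : RS ω S (AA f g) (BB f g) μ δ ρm ρM ρ)
    (hf : ∀ r v w, 0 ≤ r → f (r * v) (r * w) = r ^ 2 * f v w)
    (hg : ∀ r v w, 0 ≤ r → g (r * v) (r * w) = r ^ 2 * g v w) :
    ∃ φ : ℝ → ℝ, IsPeriodicSolution2 (PF ω f g μ) (fun t => P ρ (φ t)) ∧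
      range (fun t => P ρ (φ t)) = range (P ρ) := by
  obtain ⟨φ, hφ, hsurj, hφ0, huq⟩ := angle_ode (fun x => ω + BB f g x / ρ x) H.tc ω H.hω (fun x => by
    rw [add_sub_cancel_left]; exact H.hBρ x)
  have hPp : ∀ x, P ρ (x + 2 * π) = P ρ x := fun x => by simp [P, H.hp]
  refine ⟨φ, ⟨?_, ?_, ?_⟩, ?_⟩
  · refine polar_sol (fun t => 1 / ρ (φ t)) φ hf hg (fun t => by have := H.pos (φ t); positivity)
      (fun t => ?_) (fun t => ?_)
    · have e : (fun t => 1 / ρ (φ t)) = (ρ ∘ φ)⁻¹ := by ext t; simp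
      have h1 := ((H.hd (φ t)).comp t (hφ t)).inv (H.pos (φ t)).ne'
      rw [← e] at h1
      refine h1.congr_deriv ?_
      have := (H.pos (φ t)).ne'
      rw [div_mul_cancel₀ _ (H.den _), Function.comp]
      field_simp
    · refine (hφ t).congr_deriv ?_
      ring
  · obtain ⟨c, hc⟩ := huq (fun t => φ t + 2 * π) (fun t => by
      refine ((hφ t).add_const (2 * π)).congr_deriv ?_
      rw [H.hBp, H.hp])
    have hc0 : c ≠ 0 := by
      intro h
      have := hc 0
      rw [h, add_zero] at this
      linarith [Real.pi_pos]
    have hcp : ∀ t, P ρ (φ (t + c)) = P ρ (φ t) := fun t => by rw [← hc t, hPp]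
    rcases lt_or_gt_of_ne hc0 with h | h
    · refine ⟨-c, by linarith, fun t => ?_⟩
      have := hcp (t + -c)
      rw [neg_add_cancel_right] at this
      exact this.symm
    · exact ⟨c, h, hcp⟩
  · intro h
    obtain ⟨t, ht⟩ := hsurj π
    have := congrArg Prod.fst (h t)
    simp only [P, ht, hφ0, cos_pi, cos_zero] at this
    have h1 := one_div_pos.2 (H.pos π)
    have h2 := one_div_pos.2 (H.pos 0)
    linarith
  · exact hsurj.range_comp (P ρ)

lemma ampl (H : RS ω S (AA f g) (BB f g) μ δ ρm ρM ρ) (φ : ℝ → ℝ) (a e : ℝ)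
    (h : ∀ x, |1 / ρ x - a| ≤ e) :
    0 < ampl2 (fun t => P ρ (φ t)) ∧ ampl2 (fun t => P ρ (φ t)) < δ ∧
      |ampl2 (fun t => P ρ (φ t)) - a| ≤ e := by
  have hn : ∀ t, √((P ρ (φ t)).1 ^ 2 + (P ρ (φ t)).2 ^ 2) = 1 / ρ (φ t) := fun t =>
    polar_norm _ _ (one_div_pos.2 (H.pos (φ t)))
  have hb : ∀ x, 1 / ρ x ≤ 1 / ρm := fun x => one_div_le_one_div_of_le H.hm0 (H.hlo x)
  have hbd : BddAbove (range fun t => 1 / ρ (φ t)) := ⟨1 / ρm, by rintro _ ⟨t, rfl⟩; exact hb _⟩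
  have h0 := le_ciSup hbd 0
  unfold ampl2
  simp only [hn]
  refine ⟨(one_div_pos.2 (H.pos (φ 0))).trans_le h0, (ciSup_le fun t => hb (φ t)).trans_lt ?_, ?_⟩
  · rw [div_lt_iff₀ H.hm0]; exact H.hmδ
  · rw [abs_le]
    constructor
    · linarith [(abs_le.1 (h (φ 0))).1]
    · have : ⨆ t, 1 / ρ (φ t) ≤ a + e := ciSup_le fun t => by linarith [(abs_le.1 (h (φ t))).2]
      linarith

end RS


set_option maxHeartbeats 4000000

/-- Degenerate Hopf bifurcation for the planar system
`v' = μv − ωw + f(v,w)`, `w' = ωv + μw + g(v,w)` with pure second-order modulus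
nonlinearities: if `σ_# = 2a₁₁ + a₁₂ + b₂₁ + 2b₂₂ ≠ 0`, then for all small `μ ≠ 0` with
`μσ_# < 0` there is a nonconstant periodic solution of amplitude
`−3πμ/(2σ_#) + O(μ²)`, unique up to time translation among small periodic solutions,
orbitally asymptotically stable for `μ > 0` and orbitally unstable for `μ < 0`; while for
`μσ_# > 0` there is no small nonconstant periodic solution. -/
theorem stmt4 (ω : ℝ) (hω : ω ≠ 0)
    (a11 a12 a21 a22 b11 b12 b21 b22 : ℝ)
    (σ : ℝ) (hσdef : σ = 2 * a11 + a12 + b21 + 2 * b22) (hσ : σ ≠ 0)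
    (F : ℝ → ℝ × ℝ → ℝ × ℝ)
    (hF : ∀ μ p, F μ p =
      (μ * p.1 - ω * p.2 +
        (a11 * p.1 * |p.1| + a12 * p.1 * |p.2| + a21 * p.2 * |p.1| + a22 * p.2 * |p.2|),
       ω * p.1 + μ * p.2 +
        (b11 * p.1 * |p.1| + b12 * p.1 * |p.2| + b21 * p.2 * |p.1| + b22 * p.2 * |p.2|))) :
    ∃ ε > 0, ∃ δ > 0, ∃ C > 0, ∀ μ : ℝ, 0 < |μ| → |μ| < ε →
      ((μ * σ < 0 →
        ∃ u : ℝ → ℝ × ℝ, IsPeriodicSolution2 (F μ) u ∧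
          0 < ampl2 u ∧ ampl2 u < δ ∧
          |ampl2 u + 3 * π * μ / (2 * σ)| ≤ C * μ ^ 2 ∧
          (0 < μ → OrbitallyAsympStable2 (F μ) (Set.range u)) ∧
          (μ < 0 → ¬ OrbitallyStable2 (F μ) (Set.range u))) ∧
       (∀ u₁ u₂ : ℝ → ℝ × ℝ,
          IsPeriodicSolution2 (F μ) u₁ → IsPeriodicSolution2 (F μ) u₂ →
          ampl2 u₁ < δ → ampl2 u₂ < δ →
          ∃ s : ℝ, ∀ t, u₂ t = u₁ (t + s)) ∧
       (0 < μ * σ →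
        ¬ ∃ u : ℝ → ℝ × ℝ, IsPeriodicSolution2 (F μ) u ∧ ampl2 u < δ)) := by
  have hFe : ∀ μ, F μ = PF ω (qq a11 a12 a21 a22) (qq b11 b12 b21 b22) μ := fun μ => by
    funext p; rw [hF]; rfl
  set f := qq a11 a12 a21 a22 with hfdef
  set g := qq b11 b12 b21 b22 with hgdef
  have hpi := Real.pi_pos
  have hω' := abs_pos.2 hω
  set Ab : ℝ := 2 * σ / (3 * π) with hAbdef
  have hAb : Ab ≠ 0 := by rw [hAbdef]; positivity
  have hAb' := abs_pos.2 hAb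
  set S1 : ℝ := (|a11| + |a12| + |a21| + |a22|) + (|b11| + |b12| + |b21| + |b22|) with hS1
  have hS10 : 0 ≤ S1 := by positivity
  have hfS1 : ∀ v w, |f v w| ≤ S1 * (v ^ 2 + w ^ 2) := fun v w => by
    refine (qq_bound _ _ _ _ v w).trans (mul_le_mul_of_nonneg_right ?_ (by positivity))
    have : 0 ≤ |b11| + |b12| + |b21| + |b22| := by positivity
    linarith
  have hgS1 : ∀ v w, |g v w| ≤ S1 * (v ^ 2 + w ^ 2) := fun v w => by
    refine (qq_bound _ _ _ _ v w).trans (mul_le_mul_of_nonneg_right ?_ (by positivity))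
    have : 0 ≤ |a11| + |a12| + |a21| + |a22| := by positivity
    linarith
  set S : ℝ := 2 * S1 + |Ab| + 1 with hSdef
  have hS : 0 < S := by positivity
  have hAbS : |Ab| ≤ S := by linarith
  have hfS : ∀ v w, |f v w| ≤ S * (v ^ 2 + w ^ 2) := fun v w =>
    (hfS1 v w).trans (mul_le_mul_of_nonneg_right (by linarith) (by positivity))
  have hgS : ∀ v w, |g v w| ≤ S * (v ^ 2 + w ^ 2) := fun v w =>
    (hgS1 v w).trans (mul_le_mul_of_nonneg_right (by linarith) (by positivity))
  have hA : ∀ x, |AA f g x| ≤ S := fun x => (AA_bound hfS1 hgS1 x).trans (by linarith)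
  have hB : ∀ x, |BB f g x| ≤ S := fun x => (BB_bound hfS1 hgS1 x).trans (by linarith)
  have hf : ∀ r v w, 0 ≤ r → f (r * v) (r * w) = r ^ 2 * f v w := fun r v w hr => qq_hom _ _ _ _ r v w hr
  have hg : ∀ r v w, 0 ≤ r → g (r * v) (r * w) = r ^ 2 * g v w := fun r v w hr => qq_hom _ _ _ _ r v w hr
  have hfc : Continuous (Function.uncurry f) := qq_cont _ _ _ _
  have hgc : Continuous (Function.uncurry g) := qq_cont _ _ _ _
  have hAc := AA_cont hfc hgc
  have hBc := BB_cont hfc hgc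
  obtain ⟨ψ, Ψ, hψp, hψ, hψS⟩ := exists_psi hAc (AA_per f g) Ab (by
    rw [hfdef, hgdef, AA_integral, ← hσdef, hAbdef]; field_simp; norm_num)
  obtain ⟨ε0, hε0, N, hN, hrho⟩ := rho_star ω hω (AA f g) (BB f g) ψ Ab S Ψ hAc hBc
    (AA_per f g) (BB_per f g) hψp hψ hA hB hAbS hψS hAb
  set C5 : ℝ := (1 + 2 * S / |Ab|) * S * 2 / |ω| with hC5
  have hC50 : 0 < C5 := by positivity
  set δ : ℝ := min (1 / (2 * C5)) (|Ab| * |ω| / (4 * S ^ 2)) with hδdef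
  have hδ : 0 < δ := by positivity
  have hδ1 : δ ≤ 1 / (2 * C5) := min_le_left _ _
  have hδ2 : δ ≤ |Ab| * |ω| / (4 * S ^ 2) := min_le_right _ _
  have hsgn : ∀ μ, μ * Ab = (μ * σ) * (2 / (3 * π)) := fun μ => by rw [hAbdef]; ring
  have hq : 0 < 2 / (3 * π) := by positivity
  -- the invariant curve
  have hRS : ∀ μ, 0 < |μ| → |μ| < min ε0 (δ * |Ab| / 2) → μ * σ < 0 →
      ∃ ρm ρM, ∃ ρ : ℝ → ℝ, RS ω S (AA f g) (BB f g) μ δ ρm ρM ρ ∧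
        ∀ x, |1 / ρ x - -(3 * π * μ / (2 * σ))| ≤ (2 * N / Ab ^ 2) * μ ^ 2 := by
    intro μ hμ0 hμε hμσ
    have hμ : μ ≠ 0 := abs_pos.1 hμ0
    have hμAb : μ * Ab < 0 := by rw [hsgn]; exact mul_neg_of_neg_of_pos hμσ hq
    obtain ⟨hN2, ρ, hd, hp, hρN, hBρ⟩ := hrho μ hμAb (hμε.trans_le (min_le_left _ _))
    have hμ2 : |μ| < δ * |Ab| / 2 := hμε.trans_le (min_le_right _ _)
    have hρ0 : -Ab / μ = |Ab| / |μ| := by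
      rw [← abs_div, neg_div, ← abs_neg, abs_of_pos]
      rw [← neg_div, div_eq_mul_inv]
      have : -Ab * μ⁻¹ = -(μ * Ab) / μ ^ 2 := by field_simp
      rw [this]
      exact div_pos (by linarith) (by positivity)
    rw [hρ0] at hN2 hρN
    have hhalf : |Ab| / (2 * |μ|) = |Ab| / |μ| / 2 := by field_simp
    have hm0 : 0 < |Ab| / (2 * |μ|) := by positivity
    have hlo : ∀ x, |Ab| / (2 * |μ|) ≤ ρ x := fun x => by
      rw [hhalf]; linarith [(abs_le.1 (hρN x)).1]
    have hpos : ∀ x, 0 < ρ x := fun x => hm0.trans_le (hlo x)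
    have hinv : ∀ x, 1 / ρ x ≤ 2 * |μ| / |Ab| := fun x => by
      rw [← one_div_div |Ab| (2 * |μ|)]; exact one_div_le_one_div_of_le hm0 (hlo x)
    refine ⟨|Ab| / (2 * |μ|), 2 * (|Ab| / |μ|), ρ, ⟨hω, hS, hδ, hA, hB, hAc, hBc, AA_per f g, BB_per f g, hμ, hm0,
      ?_, hlo, fun x => ?_, hd, hp, hBρ, fun x => ?_⟩, fun x => ?_⟩
    · rw [← mul_div_assoc, lt_div_iff₀ (by positivity)]; linarith
    · linarith [(abs_le.1 (hρN x)).2]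
    · have hden := RS.den_abs (hBρ x)
      have h1 : |μ + AA f g x / ρ x| ≤ |μ| + S * (2 * |μ| / |Ab|) := by
        refine (abs_add_le _ _).trans ?_
        rw [abs_div, abs_of_pos (hpos x), div_eq_mul_one_div |AA f g x|]
        have := hA x
        have := hinv x
        have := hpos x
        gcongr
      have h2 : |mm ω (AA f g) (BB f g) μ ρ x| ≤ |μ| * C5 := by
        unfold mm
        rw [abs_div, abs_mul]
        have := hB x
        calc |μ + AA f g x / ρ x| * |BB f g x| / |ω + BB f g x / ρ x|
            ≤ (|μ| + S * (2 * |μ| / |Ab|)) * S / (|ω| / 2) := by gcongr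
          _ = |μ| * C5 := by rw [hC5]; field_simp
      calc δ * |mm ω (AA f g) (BB f g) μ ρ x| ≤ (1 / (2 * C5)) * (|μ| * C5) := by gcongr
        _ = |μ| / 2 := by field_simp
    · have e : -(3 * π * μ / (2 * σ)) = 1 / (|Ab| / |μ|) := by
        rw [← hρ0, hAbdef]; field_simp
      rw [e]
      have hr0 : 0 < |Ab| / |μ| := by positivity
      have e2 : 1 / ρ x - 1 / (|Ab| / |μ|) = -(ρ x - |Ab| / |μ|) * ((1 / ρ x) * (1 / (|Ab| / |μ|))) := by
        have := hpos x
        generalize |Ab| / |μ| = z at *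
        field_simp
        ring
      rw [e2, abs_mul, abs_neg, abs_of_pos (show 0 < (1 / ρ x) * (1 / (|Ab| / |μ|)) by
        have := hpos x; positivity)]
      calc abs (ρ x - |Ab| / |μ|) * ((1 / ρ x) * (1 / (|Ab| / |μ|)))
          ≤ N * ((2 * |μ| / |Ab|) * (1 / (|Ab| / |μ|))) := by
            have h1 := hρN x
            have h2 := hinv x
            have h3 := hpos x
            gcongr
        _ = (2 * N / |Ab| ^ 2) * |μ| ^ 2 := by field_simp
        _ = _ := by rw [sq_abs, sq_abs]
  have hno : ∀ μ, 0 < μ * σ → ∀ u, IsPeriodicSolution2 (F μ) u → ampl2 u < δ → False := by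
    intro μ hμσ u hu ha
    rw [hFe] at hu
    exact nonexist hω hS hf hg hfc hgc hfS hgS hA hB hAbS hAb hψp hψ hδ2
      (by rw [hsgn]; positivity) hu ha
  refine ⟨min ε0 (δ * |Ab| / 2), by positivity, δ, hδ, 2 * N / Ab ^ 2, by positivity, fun μ hμ0 hμε => ⟨?_, ?_, ?_⟩⟩
  · intro hμσ
    obtain ⟨ρm, ρM, ρ, H, hest⟩ := hRS μ hμ0 hμε hμσ
    obtain ⟨φ, hper, hran⟩ := H.exis hf hg
    obtain ⟨h1, h2, h3⟩ := H.ampl φ _ _ hest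
    rw [hFe]
    refine ⟨_, hper, h1, h2, ?_, fun h => ?_, fun h => ?_⟩
    · rw [sub_neg_eq_add] at h3; exact h3
    · rw [hran]; exact H.stable h hf hg hfc hgc hfS hgS
    · rw [hran]; exact H.unstable h hf hg
  · intro u₁ u₂ hu1 hu2 ha1 ha2
    have hne : μ * σ ≠ 0 := mul_ne_zero (abs_pos.1 hμ0) hσ
    rcases lt_or_gt_of_ne hne with h | h
    · obtain ⟨ρm, ρM, ρ, H, -⟩ := hRS μ hμ0 hμε h
      rw [hFe] at hu1 hu2
      exact H.uniq hf hg hfc hgc hfS hgS hu1 hu2 ha1 ha2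
    · exact (hno μ h u₁ hu1 ha1).elim
  · rintro hμσ ⟨u, hu, ha⟩
    exact hno μ hμσ u hu ha
end
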